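/- Let (Q,R) be a gentle presentation and T a spanning tree of Q. The cohomology of the complex k(Γ∥B) is, as a graded vector space, freely generated by the cohomology classes of the following homogeneous cocycles: (H_I) the element 𝟙 = Σ_{i∈Q_0}(e_i,e_i); (H_II) the pairs (s(α),α) with α a B-maximal path; (H_III) the sums ⟨α⟩ = Σ_{i=0}^{r−1}(s(rot^i(α)), rot^i(α)) with α ∈ Crep(B) of period r; (H_IV) the pairs (c,c) with c an arrow in Q_1 ∖ T; (H_V) the pairs (c, cα) with α ∈ Crep(B) and c the first arrow of α; (H_VI) the pairs (γ,α) with γ a Γ-maximal element of Γ and γ and α neither beginning nor ending with the same arrow; (H_VII) for each C ∈ Crep°_m(Γ) with m even or char(k) = 2, the sums ⟨C⟩ = Σ_{i=0}^{r−1}(−1)^{im}(rot^i(C), s(rot^i(C))) (r the period of C); (H_VIII) the pairs (bC, b) with C ∈ Crep°_{m−1}(Γ), b the first arrow of C, and m odd or char(k) = 2. (The paper identifies this cohomology with the Hochschild cohomology HH^*(kQ/⟨R⟩).) -/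

import Mathlib

/-!
Common framework: quivers, paths (as a start vertex together with a list of
composable arrows, listed in order of traversal, so that the paper's path
`c_m ⋯ c_1` corresponds to the list `[c_1, …, c_m]`), gentle and quadratic
monomial presentations, the cochain complex `k(Γ ∥ B)` and the chain complex
`k(B ⊙ Γ)` of the paper.
-/

namespace GentleTT

structure Quiv where
  V : Type
  A : Type
  [fintV : Fintype V]
  [fintA : Fintype A]
  [decV : DecidableEq V]
  [decA : DecidableEq A]
  src : A → V
  tgt : A → V

attribute [instance] Quiv.fintV Quiv.fintA Quiv.decV Quiv.decA

/-- A "path datum": a start vertex together with the list of arrows traversed. -/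
abbrev PathDat (Q : Quiv) := Q.V × List Q.A

def psrc (Q : Quiv) (p : PathDat Q) : Q.V := p.1

def ptgt (Q : Quiv) (p : PathDat Q) : Q.V := p.2.getLast?.elim p.1 Q.tgt

def plen (Q : Quiv) (p : PathDat Q) : ℕ := p.2.length

/-- `p` is a genuine path: consecutive arrows compose, and the recorded start
vertex is the source of the first arrow (if any). -/
def Ok (Q : Quiv) (p : PathDat Q) : Prop :=
  p.2.Chain' (fun a b => Q.tgt a = Q.src b) ∧ ∀ a ∈ p.2.head?, Q.src a = p.1

/-- `p` is a path none of whose length-2 subpaths lies in `R`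
(an element of the basis `B` of `kQ/⟨R⟩`). -/
def InB (Q : Quiv) (R : Set (Q.A × Q.A)) (p : PathDat Q) : Prop :=
  Ok Q p ∧ p.2.Chain' (fun a b => (a, b) ∉ R)

/-- `p` is a path all of whose length-2 subpaths lie in `R` (an element of `Γ`). -/
def InG (Q : Quiv) (R : Set (Q.A × Q.A)) (p : PathDat Q) : Prop :=
  Ok Q p ∧ p.2.Chain' (fun a b => (a, b) ∈ R)

/-- Parallel paths: same source and same target. -/
def Par (Q : Quiv) (p q : PathDat Q) : Prop :=
  psrc Q p = psrc Q q ∧ ptgt Q p = ptgt Q q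

/-- Antiparallel paths: `s(p) = t(q)` and `t(p) = s(q)`. -/
def AntiPar (Q : Quiv) (p q : PathDat Q) : Prop :=
  psrc Q p = ptgt Q q ∧ ptgt Q p = psrc Q q

/-- A cycle: a path of positive length whose source equals its target. -/
def IsCycle (Q : Quiv) (p : PathDat Q) : Prop :=
  Ok Q p ∧ p.2 ≠ [] ∧ psrc Q p = ptgt Q p

/-- Rotation of a cycle: the paper's `rot (c_m ⋯ c_1) = c_{m-1} ⋯ c_1 c_m`
(the last arrow traversed becomes the first one traversed). -/
def rotP (Q : Quiv) (p : PathDat Q) : PathDat Q :=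
  match p.2.getLast? with
  | none => p
  | some a => (Q.src a, a :: p.2.dropLast)

/-- Iterated rotation `rot^i`. -/
def rotI (Q : Quiv) (i : ℕ) (p : PathDat Q) : PathDat Q := (rotP Q)^[i] p

def powL {α : Type} (l : List α) : ℕ → List α
  | 0 => []
  | n + 1 => l ++ powL l n

/-- The `n`-th power `p^n` of a (cyclic) path. -/
def powP (Q : Quiv) (p : PathDat Q) (n : ℕ) : PathDat Q := (p.1, powL p.2 n)

/-- A primitive cycle: a cycle that is not a proper power of another cycle. -/
def IsPrimitive (Q : Quiv) (p : PathDat Q) : Prop :=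
  IsCycle Q p ∧ ∀ (q : PathDat Q) (n : ℕ), IsCycle Q q → 2 ≤ n → p ≠ powP Q q n

/-- The period of a cycle: the least `i ≥ 1` with `rot^i p = p`. -/
noncomputable def periodP (Q : Quiv) (p : PathDat Q) : ℕ :=
  sInf {i : ℕ | 1 ≤ i ∧ rotI Q i p = p}

/-- Two cycles are conjugate (belong to the same circuit) if one is obtained
from the other by iterated rotation. -/
def RotEquiv (Q : Quiv) (p q : PathDat Q) : Prop := ∃ i : ℕ, rotI Q i p = q

/-- A cocomplete cycle: `p² ∈ B`. -/
def Cocomplete (Q : Quiv) (R : Set (Q.A × Q.A)) (p : PathDat Q) : Prop :=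
  IsCycle Q p ∧ InB Q R (powP Q p 2)

/-- A complete cycle: `p² ∈ Γ`. -/
def Complete (Q : Quiv) (R : Set (Q.A × Q.A)) (p : PathDat Q) : Prop :=
  IsCycle Q p ∧ InG Q R (powP Q p 2)

/-- `B`-maximal path: in `B` and not a proper subpath of another element of `B`. -/
def BMax (Q : Quiv) (R : Set (Q.A × Q.A)) (p : PathDat Q) : Prop :=
  InB Q R p ∧ ∀ q : PathDat Q, InB Q R q → p.2 <:+: q.2 → p.2 = q.2

/-- `Γ`-maximal path: in `Γ` and not a proper subpath of another element of `Γ`. -/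
def GMax (Q : Quiv) (R : Set (Q.A × Q.A)) (p : PathDat Q) : Prop :=
  InG Q R p ∧ ∀ q : PathDat Q, InG Q R q → p.2 <:+: q.2 → p.2 = q.2

def Adj (Q : Quiv) (v w : Q.V) : Prop :=
  ∃ a : Q.A, (Q.src a = v ∧ Q.tgt a = w) ∨ (Q.src a = w ∧ Q.tgt a = v)

/-- Connectedness of the underlying graph of the quiver. -/
def Connected (Q : Quiv) : Prop := ∀ v w : Q.V, Relation.ReflTransGen (Adj Q) v w

/-- A quadratic monomial presentation: the relations are paths of length 2. -/
def IsQuadMon (Q : Quiv) (R : Set (Q.A × Q.A)) : Prop :=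
  ∀ r ∈ R, Q.tgt r.1 = Q.src r.2

/-- A gentle presentation. -/
structure IsGentle (Q : Quiv) (R : Set (Q.A × Q.A)) : Prop where
  nonempty : Nonempty Q.V
  connected : Connected Q
  relComposable : ∀ r ∈ R, Q.tgt r.1 = Q.src r.2
  srcLe : ∀ v : Q.V, {a : Q.A | Q.src a = v}.ncard ≤ 2
  tgtLe : ∀ v : Q.V, {a : Q.A | Q.tgt a = v}.ncard ≤ 2
  uniqNotRelAfter : ∀ a : Q.A, {b : Q.A | Q.tgt a = Q.src b ∧ (a, b) ∉ R}.Subsingleton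
  uniqNotRelBefore : ∀ a : Q.A, {c : Q.A | Q.tgt c = Q.src a ∧ (c, a) ∉ R}.Subsingleton
  uniqRelAfter : ∀ a : Q.A, {b : Q.A | Q.tgt a = Q.src b ∧ (a, b) ∈ R}.Subsingleton
  uniqRelBefore : ∀ a : Q.A, {c : Q.A | Q.tgt c = Q.src a ∧ (c, a) ∈ R}.Subsingleton

/-- A spanning tree of the (finite, connected) quiver `Q`: a set of arrows
which connects all vertices and has exactly `|Q₀| - 1` elements. -/
def IsSpanningTree (Q : Quiv) (T : Set Q.A) : Prop :=
  (∀ v w : Q.V, Relation.ReflTransGen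
      (fun x y => ∃ a ∈ T, (Q.src a = x ∧ Q.tgt a = y) ∨ (Q.src a = y ∧ Q.tgt a = x)) v w) ∧
  T.ncard + 1 = Fintype.card Q.V

/-- A set of representatives, one for each rotation class of cycles
satisfying `Pred`. -/
def IsRepSet (Q : Quiv) (P : Set (PathDat Q)) (Pred : PathDat Q → Prop) : Prop :=
  (∀ p ∈ P, Pred p) ∧ ∀ q : PathDat Q, Pred q → ∃! p, p ∈ P ∧ RotEquiv Q q p

/-- `S` is a valid choice of the paper's set `Crep` for the predicate `Pred`
(e.g. cocompleteness, or completeness): it consists of all positive powers of a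
chosen set of representatives of the rotation classes of primitive cycles
satisfying `Pred`. -/
def IsCrep (Q : Quiv) (S : Set (PathDat Q)) (Pred : PathDat Q → Prop) : Prop :=
  ∃ P : Set (PathDat Q),
    IsRepSet Q P (fun p => IsPrimitive Q p ∧ Pred p) ∧
    S = {x | ∃ p ∈ P, ∃ n : ℕ, 1 ≤ n ∧ x = powP Q p n}

/-! ### The cochain complex `k(Γ ∥ B)` -/

/-- Membership in the degree-`m` basis `Γ_m ∥ B` of the cochain complex. -/
def GBmem (Q : Quiv) (R : Set (Q.A × Q.A)) (m : ℕ) (x : PathDat Q × PathDat Q) : Prop :=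
  InG Q R x.1 ∧ plen Q x.1 = m ∧ InB Q R x.2 ∧ Par Q x.1 x.2

abbrev GB (Q : Quiv) (R : Set (Q.A × Q.A)) (m : ℕ) :=
  {x : PathDat Q × PathDat Q // GBmem Q R m x}

/-- The degree-`m` component of the cochain complex `k(Γ ∥ B)`. -/
abbrev Coch (k : Type) [Field k] (Q : Quiv) (R : Set (Q.A × Q.A)) (m : ℕ) :=
  GB Q R m →₀ k

/-- The basis vector of `k(Γ_m ∥ B)` attached to a raw pair of path data
(and `0` if the pair is not in `Γ_m ∥ B`). -/
noncomputable def bv (k : Type) [Field k] (Q : Quiv) (R : Set (Q.A × Q.A)) (m : ℕ)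
    (x : PathDat Q × PathDat Q) : Coch k Q R m := by
  classical
  exact if h : GBmem Q R m x then Finsupp.single (⟨x, h⟩ : GB Q R m) (1 : k) else 0

/-- Extension on the left (in the paper's notation): `p ↦ b p`. -/
def extL (Q : Quiv) (b : Q.A) (p : PathDat Q) : PathDat Q := (p.1, p.2 ++ [b])

/-- Extension on the right (in the paper's notation): `p ↦ p a`. -/
def extR (Q : Quiv) (a : Q.A) (p : PathDat Q) : PathDat Q := (Q.src a, a :: p.2)

/-- The differential on a basis element:
`d^m (γ, α) = Σ_b (bγ, bα) - (-1)^m Σ_a (γa, αa)`. -/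
noncomputable def dB (k : Type) [Field k] (Q : Quiv) (R : Set (Q.A × Q.A)) (m : ℕ)
    (x : GB Q R m) : Coch k Q R (m + 1) := by
  classical
  exact
    (∑ b : Q.A,
      if h : GBmem Q R (m + 1) (extL Q b x.val.1, extL Q b x.val.2) then
        Finsupp.single (⟨_, h⟩ : GB Q R (m + 1)) (1 : k) else 0)
    - ((-1 : k) ^ m) •
      (∑ a : Q.A,
        if h : Q.tgt a = psrc Q x.val.1 ∧
            GBmem Q R (m + 1) (extR Q a x.val.1, extR Q a x.val.2) then
          Finsupp.single (⟨_, h.2⟩ : GB Q R (m + 1)) (1 : k) else 0)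

/-- The differential `d^m : k(Γ_m ∥ B) → k(Γ_{m+1} ∥ B)`. -/
noncomputable def dLin (k : Type) [Field k] (Q : Quiv) (R : Set (Q.A × Q.A)) (m : ℕ) :
    Coch k Q R m →ₗ[k] Coch k Q R (m + 1) :=
  Finsupp.linearCombination k (dB k Q R m)

/-- The element `𝟙 = Σ_{i ∈ Q₀} (e_i, e_i)` (placed in degree `m`; it is the
intended element when `m = 0`). -/
noncomputable def oneD (k : Type) [Field k] (Q : Quiv) (R : Set (Q.A × Q.A)) (m : ℕ) :
    Coch k Q R m :=
  ∑ i : Q.V, bv k Q R m ((i, []), (i, []))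

/-- `⟨α⟩ = Σ_{i=0}^{r-1} (s(rot^i α), rot^i α)`, `r` the period of `α`. -/
noncomputable def cycB (k : Type) [Field k] (Q : Quiv) (R : Set (Q.A × Q.A)) (m : ℕ)
    (α : PathDat Q) : Coch k Q R m :=
  ∑ i ∈ Finset.range (periodP Q α),
    bv k Q R m ((psrc Q (rotI Q i α), []), rotI Q i α)

/-- `⟨C⟩ = Σ_{i=0}^{r-1} (-1)^{i m} (rot^i C, s(rot^i C))`, `r` the period of `C`. -/
noncomputable def cycG (k : Type) [Field k] (Q : Quiv) (R : Set (Q.A × Q.A)) (m : ℕ)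
    (C : PathDat Q) : Coch k Q R m :=
  ∑ i ∈ Finset.range (periodP Q C),
    ((-1 : k) ^ (i * m)) • bv k Q R m (rotI Q i C, (psrc Q (rotI Q i C), []))

/-- The coboundary subspace in degree `m` (zero in degree `0`). -/
noncomputable def cobSp (k : Type) [Field k] (Q : Quiv) (R : Set (Q.A × Q.A)) :
    (m : ℕ) → Submodule k (Coch k Q R m)
  | 0 => ⊥
  | m + 1 => LinearMap.range (dLin k Q R m)

/-- The cocycle subspace in degree `m`. -/
noncomputable def cocSp (k : Type) [Field k] (Q : Quiv) (R : Set (Q.A × Q.A)) (m : ℕ) :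
    Submodule k (Coch k Q R m) :=
  LinearMap.ker (dLin k Q R m)

/-- The degree-`m` cohomology `HH^m` of the complex `k(Γ ∥ B)` vanishes:
every cocycle is a coboundary. -/
def CohomIsZero (k : Type) [Field k] (Q : Quiv) (R : Set (Q.A × Q.A)) (m : ℕ) : Prop :=
  cocSp k Q R m ≤ cobSp k Q R m

/-- The degree-`m` cohomology `HH^m` of the complex `k(Γ ∥ B)` is
finite-dimensional: there is a finite set of cocycles whose classes span it. -/
def CohomFinDim (k : Type) [Field k] (Q : Quiv) (R : Set (Q.A × Q.A)) (m : ℕ) : Prop :=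
  ∃ G : Finset (Coch k Q R m), ↑G ⊆ (cocSp k Q R m : Set (Coch k Q R m)) ∧
    cocSp k Q R m ≤ cobSp k Q R m ⊔ Submodule.span k ↑G

/-- The degree-`m` cohomology `HH^m` of the complex `k(Γ ∥ B)` has dimension at
most `n`: there are `n` cocycles whose classes span it. -/
def CohomDimLe (k : Type) [Field k] (Q : Quiv) (R : Set (Q.A × Q.A)) (m n : ℕ) : Prop :=
  ∃ G : Finset (Coch k Q R m), G.card ≤ n ∧
    ↑G ⊆ (cocSp k Q R m : Set (Coch k Q R m)) ∧
    cocSp k Q R m ≤ cobSp k Q R m ⊔ Submodule.span k ↑G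

/-- `Gen` is a basis of the kernel of `d⁰`, i.e. it freely generates `HH⁰`. -/
def FreelyGeneratesKer0 (k : Type) [Field k] (Q : Quiv) (R : Set (Q.A × Q.A))
    (Gen : Set (Coch k Q R 0)) : Prop :=
  (∀ x ∈ Gen, dLin k Q R 0 x = 0) ∧
  (∀ z : Coch k Q R 0, dLin k Q R 0 z = 0 → z ∈ Submodule.span k Gen) ∧
  LinearIndependent k (fun x : Gen => (x : Coch k Q R 0))

/-- The cohomology classes of the elements of `Gen` freely generate the
degree-`(m+1)` cohomology of `k(Γ ∥ B)`: all elements of `Gen` are cocycles,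
every cocycle is congruent to an element of their span modulo coboundaries, no
nonzero element of their span is a coboundary, and `Gen` is linearly
independent. -/
def FreelyGeneratesCohom (k : Type) [Field k] (Q : Quiv) (R : Set (Q.A × Q.A)) (m : ℕ)
    (Gen : Set (Coch k Q R (m + 1))) : Prop :=
  (∀ x ∈ Gen, dLin k Q R (m + 1) x = 0) ∧
  (∀ z : Coch k Q R (m + 1), dLin k Q R (m + 1) z = 0 →
      ∃ y : Coch k Q R m, z - dLin k Q R m y ∈ Submodule.span k Gen) ∧
  (∀ x ∈ Submodule.span k Gen, x ∈ LinearMap.range (dLin k Q R m) → x = 0) ∧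
  LinearIndependent k (fun x : Gen => (x : Coch k Q R (m + 1)))

/-! ### The chain complex `k(B ⊙ Γ)` -/

/-- Membership in the degree-`m` basis `B ⊙ Γ_m` of the chain complex. -/
def BGmem (Q : Quiv) (R : Set (Q.A × Q.A)) (m : ℕ) (x : PathDat Q × PathDat Q) : Prop :=
  InB Q R x.1 ∧ InG Q R x.2 ∧ plen Q x.2 = m ∧ AntiPar Q x.1 x.2

abbrev BGt (Q : Quiv) (R : Set (Q.A × Q.A)) (m : ℕ) :=
  {x : PathDat Q × PathDat Q // BGmem Q R m x}

/-- The degree-`m` component of the chain complex `k(B ⊙ Γ)`. -/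
abbrev Chn (k : Type) [Field k] (Q : Quiv) (R : Set (Q.A × Q.A)) (m : ℕ) :=
  BGt Q R m →₀ k

/-- The basis vector of `k(B ⊙ Γ_m)` attached to a raw pair of path data
(and `0` if the pair is not in `B ⊙ Γ_m`). -/
noncomputable def bw (k : Type) [Field k] (Q : Quiv) (R : Set (Q.A × Q.A)) (m : ℕ)
    (x : PathDat Q × PathDat Q) : Chn k Q R m := by
  classical
  exact if h : BGmem Q R m x then Finsupp.single (⟨x, h⟩ : BGt Q R m) (1 : k) else 0

/-- `l1(p)`: the last arrow of `p` (as a path of length one). -/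
def l1P (Q : Quiv) (p : PathDat Q) : PathDat Q :=
  match p.2.getLast? with
  | none => p
  | some a => (Q.src a, [a])

/-- `l2(p)`: `p` with its last arrow removed. -/
def l2P (Q : Quiv) (p : PathDat Q) : PathDat Q := (p.1, p.2.dropLast)

/-- `r1(p)`: `p` with its first arrow removed. -/
def r1P (Q : Quiv) (p : PathDat Q) : PathDat Q :=
  match p.2 with
  | [] => p
  | a :: l => (Q.tgt a, l)

/-- `r2(p)`: the first arrow of `p` (as a path of length one). -/
def r2P (Q : Quiv) (p : PathDat Q) : PathDat Q :=
  match p.2 with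
  | [] => p
  | a :: _ => (Q.src a, [a])

/-- The raw first term `(α·l1(γ), l2(γ))` of the boundary of `(α, γ)`. -/
def d1raw (Q : Quiv) (x : PathDat Q × PathDat Q) : PathDat Q × PathDat Q :=
  match x.2.2.getLast? with
  | none => x
  | some a => ((Q.src a, a :: x.1.2), (x.2.1, x.2.2.dropLast))

/-- The raw second term `(r2(γ)·α, r1(γ))` of the boundary of `(α, γ)`. -/
def d2raw (Q : Quiv) (x : PathDat Q × PathDat Q) : PathDat Q × PathDat Q :=
  match x.2.2 with
  | [] => x
  | c :: l => ((x.1.1, x.1.2 ++ [c]), (Q.tgt c, l))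

/-- The boundary of a basis element:
`d_m (α, γ) = (α·l1(γ), l2(γ)) + (-1)^m (r2(γ)·α, r1(γ))` (in degree `m = m+1`),
where pairs whose first component is not in `B` are interpreted as `0`. -/
noncomputable def bdB (k : Type) [Field k] (Q : Quiv) (R : Set (Q.A × Q.A)) (m : ℕ)
    (x : BGt Q R (m + 1)) : Chn k Q R m :=
  bw k Q R m (d1raw Q x.val) + ((-1 : k) ^ (m + 1)) • bw k Q R m (d2raw Q x.val)

/-- The boundary map `d_{m+1} : k(B ⊙ Γ_{m+1}) → k(B ⊙ Γ_m)`. -/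
noncomputable def bd (k : Type) [Field k] (Q : Quiv) (R : Set (Q.A × Q.A)) (m : ℕ) :
    Chn k Q R (m + 1) →ₗ[k] Chn k Q R m :=
  Finsupp.linearCombination k (bdB k Q R m)

/-- The subspace of cycles in degree `m` (everything in degree `0`). -/
noncomputable def ZSp (k : Type) [Field k] (Q : Quiv) (R : Set (Q.A × Q.A)) :
    (m : ℕ) → Submodule k (Chn k Q R m)
  | 0 => ⊤
  | m + 1 => LinearMap.ker (bd k Q R m)

/-- The subspace of boundaries in degree `m`. -/
noncomputable def BSp (k : Type) [Field k] (Q : Quiv) (R : Set (Q.A × Q.A)) (m : ℕ) :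
    Submodule k (Chn k Q R m) :=
  LinearMap.range (bd k Q R m)

/-- The degree-`m` homology `HH_m` of the complex `k(B ⊙ Γ)` vanishes:
every cycle is a boundary. -/
def HomIsZero (k : Type) [Field k] (Q : Quiv) (R : Set (Q.A × Q.A)) (m : ℕ) : Prop :=
  ZSp k Q R m ≤ BSp k Q R m

/-- The degree-`m` homology `HH_m` of the complex `k(B ⊙ Γ)` is
finite-dimensional: there is a finite set of cycles whose classes span it. -/
def HomFinDim (k : Type) [Field k] (Q : Quiv) (R : Set (Q.A × Q.A)) (m : ℕ) : Prop :=
  ∃ G : Finset (Chn k Q R m), ↑G ⊆ (ZSp k Q R m : Set (Chn k Q R m)) ∧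
    ZSp k Q R m ≤ BSp k Q R m ⊔ Submodule.span k ↑G

/-- The concatenation `α γ` of an antiparallel pair (a cycle, or a trivial path). -/
def concatP (Q : Quiv) (x : PathDat Q × PathDat Q) : PathDat Q := (x.2.1, x.2.2 ++ x.1.2)

/-- The degree-`m` component of the subcomplex `k(B ⊙ Γ)_C`, spanned by the
basis elements whose concatenation lies in the circuit (rotation class) of `c`. -/
noncomputable def Wsp (k : Type) [Field k] (Q : Quiv) (R : Set (Q.A × Q.A))
    (c : PathDat Q) (m : ℕ) : Submodule k (Chn k Q R m) :=
  Submodule.span k {z : Chn k Q R m |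
    ∃ x : BGt Q R m, RotEquiv Q (concatP Q x.val) c ∧ z = Finsupp.single x (1 : k)}

/-- The boundaries of the subcomplex `k(B ⊙ Γ)_C` in degree `m`. -/
noncomputable def WB (k : Type) [Field k] (Q : Quiv) (R : Set (Q.A × Q.A))
    (c : PathDat Q) (m : ℕ) : Submodule k (Chn k Q R m) :=
  Submodule.map (bd k Q R m) (Wsp k Q R c (m + 1))

/-- The cycles of the subcomplex `k(B ⊙ Γ)_C` in degree `m`. -/
noncomputable def WZ (k : Type) [Field k] (Q : Quiv) (R : Set (Q.A × Q.A))
    (c : PathDat Q) (m : ℕ) : Submodule k (Chn k Q R m) :=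
  ZSp k Q R m ⊓ Wsp k Q R c m

/-- The degree-`m` homology of `k(B ⊙ Γ)_C` is one-dimensional, spanned by the
homology class of `v`. -/
def SubHomSpannedBy (k : Type) [Field k] (Q : Quiv) (R : Set (Q.A × Q.A))
    (c : PathDat Q) (m : ℕ) (v : Chn k Q R m) : Prop :=
  v ∈ WZ k Q R c m ∧ v ∉ WB k Q R c m ∧
  ∀ z ∈ WZ k Q R c m, ∃ t : k, z - t • v ∈ WB k Q R c m

/-- `ĥ(c) = Σ_{i=0}^{r-1} (r1(rot^i c), r2(rot^i c))` (degree 1, for cocomplete cycles;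
placed in degree `m`). -/
noncomputable def hCycR (k : Type) [Field k] (Q : Quiv) (R : Set (Q.A × Q.A)) (m : ℕ)
    (c : PathDat Q) : Chn k Q R m :=
  ∑ i ∈ Finset.range (periodP Q c),
    bw k Q R m (r1P Q (rotI Q i c), r2P Q (rotI Q i c))

/-- `ĥ(c) = Σ_{i=0}^{r-1} (-1)^{(m+1) i} (s(rot^i c), rot^i c)` (degree `m`, for
complete cycles of length `m`). -/
noncomputable def hCycM (k : Type) [Field k] (Q : Quiv) (R : Set (Q.A × Q.A)) (m : ℕ)
    (c : PathDat Q) : Chn k Q R m :=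
  ∑ i ∈ Finset.range (periodP Q c),
    ((-1 : k) ^ ((m + 1) * i)) • bw k Q R m ((psrc Q (rotI Q i c), []), rotI Q i c)

/-- The homology classes of the elements of `Gen` freely generate the degree-`m`
homology of `k(B ⊙ Γ)`. -/
def FreelyGeneratesHom (k : Type) [Field k] (Q : Quiv) (R : Set (Q.A × Q.A)) (m : ℕ)
    (Gen : Set (Chn k Q R m)) : Prop :=
  (∀ x ∈ Gen, x ∈ ZSp k Q R m) ∧
  (∀ z ∈ ZSp k Q R m, ∃ y : Chn k Q R (m + 1), z - bd k Q R m y ∈ Submodule.span k Gen) ∧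
  (∀ x ∈ Submodule.span k Gen, x ∈ LinearMap.range (bd k Q R m) → x = 0) ∧
  LinearIndependent k (fun x : Gen => (x : Chn k Q R m))

/-- The generating set of Theorem `thm:cohomology:basis` in each degree `m`:
(H_I) the element `𝟙`; (H_II) the pairs `(s(α), α)` with `α` `B`-maximal;
(H_III) the sums `⟨α⟩` with `α ∈ Crep(B) = Sb`; (H_IV) the pairs `(c, c)` with
`c ∉ T`; (H_V) the pairs `(c, cα)` with `α ∈ Sb` and `c` its first arrow;
(H_VI) the pairs `(γ, α)` with `γ` `Γ`-maximal, `γ` and `α` neither beginning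
nor ending with the same arrow; (H_VII) the sums `⟨C⟩` with `C ∈ Crep°(Γ) = Sg`
of length `m` even or `char k = 2`; (H_VIII) the pairs `(bC, b)` with
`C ∈ Sg` of length `m - 1`, `b` its first arrow, `m` odd or `char k = 2`. -/
def GenAll (k : Type) [Field k] (Q : Quiv) (R : Set (Q.A × Q.A)) (T : Set Q.A)
    (Sb Sg : Set (PathDat Q)) (m : ℕ) : Set (Coch k Q R m) :=
  {x | m = 0 ∧ x = oneD k Q R m} ∪
  {x | m = 0 ∧ ∃ α : PathDat Q, BMax Q R α ∧ GBmem Q R m ((psrc Q α, []), α) ∧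
       x = bv k Q R m ((psrc Q α, []), α)} ∪
  {x | m = 0 ∧ ∃ α ∈ Sb, x = cycB k Q R m α} ∪
  {x | m = 1 ∧ ∃ c : Q.A, c ∉ T ∧ x = bv k Q R m ((Q.src c, [c]), (Q.src c, [c]))} ∪
  {x | m = 1 ∧ ∃ α ∈ Sb, ∃ c : Q.A, α.2.head? = some c ∧
       x = bv k Q R m ((Q.src c, [c]), (α.1, α.2 ++ [c]))} ∪
  {x | ∃ γ α : PathDat Q, GMax Q R γ ∧ GBmem Q R m (γ, α) ∧
       γ.2.head? ≠ α.2.head? ∧ γ.2.getLast? ≠ α.2.getLast? ∧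
       x = bv k Q R m (γ, α)} ∪
  {x | (Even m ∨ ringChar k = 2) ∧ ∃ C ∈ Sg, plen Q C = m ∧ x = cycG k Q R m C} ∪
  {x | (Odd m ∨ ringChar k = 2) ∧ ∃ C ∈ Sg, ∃ b : Q.A, C.2.head? = some b ∧
       plen Q C + 1 = m ∧ x = bv k Q R m ((C.1, C.2 ++ [b]), (Q.src b, [b]))}

end GentleTT

namespace GentleTT

/-! ### Basic facts on paths -/

structure Gtl (Q : Quiv) (S S' : Set (Q.A × Q.A)) : Prop where
  comp : ∀ {a b}, (a, b) ∈ S → Q.tgt a = Q.src b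
  comp' : ∀ {a b}, (a, b) ∈ S' → Q.tgt a = Q.src b
  fwd : ∀ {a b b'}, (a, b) ∈ S → (a, b') ∈ S → b = b'
  fwd' : ∀ {a b b'}, (a, b) ∈ S' → (a, b') ∈ S' → b = b'
  bwd : ∀ {a a' b}, (a, b) ∈ S → (a', b) ∈ S → a = a'
  bwd' : ∀ {a a' b}, (a, b) ∈ S' → (a', b) ∈ S' → a = a'
  excl : ∀ {a b}, (a, b) ∈ S → (a, b) ∈ S' → False
  tot : ∀ {a b}, Q.tgt a = Q.src b → (a, b) ∈ S ∨ (a, b) ∈ S'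

theorem Gtl.swap {Q : Quiv} {S S' : Set (Q.A × Q.A)} (h : Gtl Q S S') : Gtl Q S' S where
  comp := h.comp'
  comp' := h.comp
  fwd := h.fwd'
  fwd' := h.fwd
  bwd := h.bwd'
  bwd' := h.bwd
  excl := fun a b => h.excl b a
  tot := fun a => (h.tot a).symm

/-- The composable pairs which are not relations. -/
def cpl (Q : Quiv) (R : Set (Q.A × Q.A)) : Set (Q.A × Q.A) :=
  {p | Q.tgt p.1 = Q.src p.2 ∧ p ∉ R}

theorem gtl_of_gentle {Q : Quiv} {R : Set (Q.A × Q.A)} (hg : IsGentle Q R) :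
    Gtl Q R (cpl Q R) where
  comp := fun h => hg.relComposable _ h
  comp' := fun h => h.1
  fwd := fun h h' => hg.uniqRelAfter _ ⟨hg.relComposable _ h, h⟩ ⟨hg.relComposable _ h', h'⟩
  fwd' := fun h h' => hg.uniqNotRelAfter _ h h'
  bwd := fun h h' => hg.uniqRelBefore _ ⟨hg.relComposable _ h, h⟩ ⟨hg.relComposable _ h', h'⟩
  bwd' := fun h h' => hg.uniqNotRelBefore _ h h'
  excl := fun h h' => h'.2 h
  tot := fun {a b} h => by
    by_cases hh : (a, b) ∈ R
    · exact Or.inl hh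
    · exact Or.inr ⟨h, hh⟩

/-- Paths all of whose length two subpaths lie in `S`. -/
def PG (Q : Quiv) (S : Set (Q.A × Q.A)) (p : PathDat Q) : Prop :=
  p.2.IsChain (fun a b => (a, b) ∈ S) ∧ ∀ a ∈ p.2.head?, Q.src a = p.1

theorem InG_iff {Q : Quiv} {S : Set (Q.A × Q.A)} (hc : ∀ {a b}, (a, b) ∈ S → Q.tgt a = Q.src b)
    (p : PathDat Q) : InG Q S p ↔ PG Q S p := by
  unfold InG Ok PG
  constructor
  · rintro ⟨⟨_, h2⟩, h3⟩
    exact ⟨h3, h2⟩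
  · rintro ⟨h1, h2⟩
    exact ⟨⟨h1.imp (fun a b h => hc h), h2⟩, h1⟩

theorem InB_iff {Q : Quiv} {R : Set (Q.A × Q.A)} (p : PathDat Q) :
    InB Q R p ↔ PG Q (cpl Q R) p := by
  unfold InB Ok PG
  constructor
  · rintro ⟨⟨h1, h2⟩, h3⟩
    refine ⟨?_, h2⟩
    rw [List.isChain_iff_getElem]
    exact fun i hi => ⟨List.isChain_iff_getElem.1 h1 i hi, List.isChain_iff_getElem.1 h3 i hi⟩
  · rintro ⟨h1, h2⟩
    exact ⟨⟨h1.imp (fun a b h => h.1), h2⟩, h1.imp (fun a b h => h.2)⟩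

def Mem (Q : Quiv) (S S' : Set (Q.A × Q.A)) (x : PathDat Q × PathDat Q) : Prop :=
  PG Q S x.1 ∧ PG Q S' x.2 ∧ Par Q x.1 x.2

theorem Mem.swap {Q : Quiv} {S S' : Set (Q.A × Q.A)} {x : PathDat Q × PathDat Q}
    (h : Mem Q S S' x) : Mem Q S' S x.swap :=
  ⟨h.2.1, h.1, h.2.2.1.symm, h.2.2.2.symm⟩

theorem GBmem_iff {Q : Quiv} {R : Set (Q.A × Q.A)} (hg : Gtl Q R (cpl Q R)) (m : ℕ)
    (x : PathDat Q × PathDat Q) :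
    GBmem Q R m x ↔ Mem Q R (cpl Q R) x ∧ x.1.2.length = m := by
  unfold GBmem Mem plen
  rw [InG_iff hg.comp, InB_iff]
  tauto

@[simp] theorem ptgt_extL {Q : Quiv} (b : Q.A) (p : PathDat Q) :
    ptgt Q (extL Q b p) = Q.tgt b := by
  simp [ptgt, extL]

theorem ptgt_extR {Q : Quiv} (a : Q.A) (p : PathDat Q) (h : Q.tgt a = p.1) :
    ptgt Q (extR Q a p) = ptgt Q p := by
  obtain ⟨v, l⟩ := p
  rcases List.eq_nil_or_concat l with rfl | ⟨l', c, rfl⟩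
  · simpa [ptgt, extR] using h
  · simp [ptgt, extR, List.getLast?_cons]

theorem ptgt_nil {Q : Quiv} (p : PathDat Q) (h : p.2 = []) : ptgt Q p = p.1 := by
  simp [ptgt, h]

theorem ptgt_last {Q : Quiv} (p : PathDat Q) {c : Q.A} (h : p.2.getLast? = some c) :
    ptgt Q p = Q.tgt c := by
  simp [ptgt, h]

section
variable {Q : Quiv} {S S' : Set (Q.A × Q.A)}

theorem PG_extL (hc : ∀ {a b}, (a, b) ∈ S → Q.tgt a = Q.src b) (b : Q.A) (p : PathDat Q) :
    PG Q S (extL Q b p) ↔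
      PG Q S p ∧ Q.src b = ptgt Q p ∧ ∀ c ∈ p.2.getLast?, (c, b) ∈ S := by
  obtain ⟨v, l⟩ := p
  rcases List.eq_nil_or_concat l with rfl | ⟨l', c, rfl⟩
  · simp [PG, extL, ptgt]
  · have h1 : ((l' ++ [c]) ++ [b]).head? = (l' ++ [c]).head? := by
      cases l' <;> simp
    simp only [PG, extL, List.concat_eq_append, List.isChain_append, h1, ptgt]
    simp
    constructor
    · rintro ⟨⟨h1, h2⟩, h3⟩
      exact ⟨⟨h1, h3⟩, (hc h2).symm, h2⟩
    · rintro ⟨⟨h1, h3⟩, _, h2⟩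
      exact ⟨⟨h1, h2⟩, h3⟩

theorem PG_extR (hc : ∀ {a b}, (a, b) ∈ S → Q.tgt a = Q.src b) (a : Q.A) (p : PathDat Q)
    (h : Q.tgt a = p.1) :
    PG Q S (extR Q a p) ↔ PG Q S p ∧ ∀ c ∈ p.2.head?, (a, c) ∈ S := by
  obtain ⟨v, l⟩ := p
  cases l with
  | nil => simp [PG, extR]
  | cons c l =>
    simp [PG, extR, List.isChain_cons_cons]
    constructor
    · rintro ⟨h1, h2⟩
      exact ⟨⟨h2, by rw [← hc h1, h]⟩, h1⟩
    · rintro ⟨⟨h1, _⟩, h2⟩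
      exact ⟨h2, h1⟩

def xL (Q : Quiv) (b : Q.A) (x : PathDat Q × PathDat Q) : PathDat Q × PathDat Q :=
  (extL Q b x.1, extL Q b x.2)

def xR (Q : Quiv) (a : Q.A) (x : PathDat Q × PathDat Q) : PathDat Q × PathDat Q :=
  (extR Q a x.1, extR Q a x.2)

def Lc (Q : Quiv) (S S' : Set (Q.A × Q.A)) (b : Q.A) (x : PathDat Q × PathDat Q) : Prop :=
  Q.src b = ptgt Q x.1 ∧ (∀ c ∈ x.1.2.getLast?, (c, b) ∈ S) ∧ ∀ c ∈ x.2.2.getLast?, (c, b) ∈ S'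

def Rc (Q : Quiv) (S S' : Set (Q.A × Q.A)) (a : Q.A) (x : PathDat Q × PathDat Q) : Prop :=
  Q.tgt a = x.1.1 ∧ (∀ c ∈ x.1.2.head?, (a, c) ∈ S) ∧ ∀ c ∈ x.2.2.head?, (a, c) ∈ S'

theorem mem_xL (hg : Gtl Q S S') (b : Q.A) (x : PathDat Q × PathDat Q) :
    Mem Q S S' (xL Q b x) ↔ Mem Q S S' x ∧ Lc Q S S' b x := by
  unfold Mem xL Lc
  simp only [PG_extL hg.comp, PG_extL hg.comp', Par, ptgt_extL, psrc]
  simp only [extL]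
  constructor
  · rintro ⟨⟨h1, h2, h3⟩, ⟨h4, h5, h6⟩, h7, -⟩
    exact ⟨⟨h1, h4, h7, h2.symm.trans h5⟩, h2, h3, h6⟩
  · rintro ⟨⟨h1, h4, h7, h5⟩, h2, h3, h6⟩
    exact ⟨⟨h1, h2, h3⟩, ⟨h4, h2.trans h5, h6⟩, h7, trivial⟩

theorem mem_xR (hg : Gtl Q S S') (a : Q.A) (x : PathDat Q × PathDat Q)
    (h : Q.tgt a = x.1.1) (h' : x.1.1 = x.2.1) :
    Mem Q S S' (xR Q a x) ↔ Mem Q S S' x ∧ Rc Q S S' a x := by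
  unfold Mem xR Rc
  simp only [PG_extR hg.comp _ _ h, PG_extR hg.comp' _ _ (h.trans h'), Par, psrc,
    ptgt_extR _ _ h, ptgt_extR _ _ (h.trans h')]
  simp only [extR]
  tauto

theorem Lc.swap {b : Q.A} {x : PathDat Q × PathDat Q} (hx : Mem Q S S' x)
    (h : Lc Q S S' b x) : Lc Q S' S b x.swap :=
  ⟨h.1.trans hx.2.2.2, h.2.2, h.2.1⟩

theorem Rc.swap {b : Q.A} {x : PathDat Q × PathDat Q} (hx : Mem Q S S' x)
    (h : Rc Q S S' b x) : Rc Q S' S b x.swap :=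
  ⟨h.1.trans hx.2.2.1, h.2.2, h.2.1⟩

theorem some_last {l : List Q.A} (h : l ≠ []) : ∃ c, l.getLast? = some c :=
  ⟨_, List.getLast?_eq_some_getLast h⟩

theorem some_head {l : List Q.A} (h : l ≠ []) : ∃ c, l.head? = some c :=
  ⟨_, List.head?_eq_some_head h⟩

def Triv (x : PathDat Q × PathDat Q) : Prop := x.1.2 = [] ∧ x.2.2 = []

theorem Lc_unique (hg : Gtl Q S S') {b b' : Q.A} {x : PathDat Q × PathDat Q} (hx : ¬ Triv x)
    (h : Lc Q S S' b x) (h' : Lc Q S S' b' x) : b = b' := by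
  by_cases h1 : x.1.2 = []
  · have h2 : x.2.2 ≠ [] := fun h2 => hx ⟨h1, h2⟩
    obtain ⟨c, hc⟩ := some_last h2
    exact hg.fwd' (h.2.2 c hc) (h'.2.2 c hc)
  · obtain ⟨c, hc⟩ := some_last h1
    exact hg.fwd (h.2.1 c hc) (h'.2.1 c hc)

theorem Rc_unique (hg : Gtl Q S S') {b b' : Q.A} {x : PathDat Q × PathDat Q} (hx : ¬ Triv x)
    (h : Rc Q S S' b x) (h' : Rc Q S S' b' x) : b = b' := by
  by_cases h1 : x.1.2 = []
  · have h2 : x.2.2 ≠ [] := fun h2 => hx ⟨h1, h2⟩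
    obtain ⟨c, hc⟩ := some_head h2
    exact hg.bwd' (h.2.2 c hc) (h'.2.2 c hc)
  · obtain ⟨c, hc⟩ := some_head h1
    exact hg.bwd (h.2.1 c hc) (h'.2.1 c hc)

def hEq (x : PathDat Q × PathDat Q) : Prop := x.1.2.head? = x.2.2.head?
def lEq (x : PathDat Q × PathDat Q) : Prop := x.1.2.getLast? = x.2.2.getLast?

theorem no_Lc (hg : Gtl Q S S') {b : Q.A} {x : PathDat Q × PathDat Q} (hx : ¬ Triv x)
    (he : lEq x) (h : Lc Q S S' b x) : False := by
  unfold lEq at he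
  by_cases h1 : x.1.2 = []
  · have h2 : x.2.2 = [] := by simpa [h1] using he.symm
    exact hx ⟨h1, h2⟩
  · obtain ⟨c, hc⟩ := some_last h1
    exact hg.excl (h.2.1 c hc) (h.2.2 c (he ▸ hc))

theorem no_Rc (hg : Gtl Q S S') {b : Q.A} {x : PathDat Q × PathDat Q} (hx : ¬ Triv x)
    (he : hEq x) (h : Rc Q S S' b x) : False := by
  unfold hEq at he
  by_cases h1 : x.1.2 = []
  · have h2 : x.2.2 = [] := by simpa [h1] using he.symm
    exact hx ⟨h1, h2⟩
  · obtain ⟨c, hc⟩ := some_head h1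
    exact hg.excl (h.2.1 c hc) (h.2.2 c (he ▸ hc))

@[simp] theorem lEq_xL (b : Q.A) (x : PathDat Q × PathDat Q) : lEq (xL Q b x) := by
  simp [lEq, xL, extL]

@[simp] theorem hEq_xR (b : Q.A) (x : PathDat Q × PathDat Q) : hEq (xR Q b x) := by
  simp [hEq, xR, extR]

theorem not_triv_xL (b : Q.A) (x : PathDat Q × PathDat Q) : ¬ Triv (xL Q b x) := by
  simp [Triv, xL, extL]

theorem not_triv_xR (b : Q.A) (x : PathDat Q × PathDat Q) : ¬ Triv (xR Q b x) := by
  simp [Triv, xR, extR]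

theorem xL_xR (a b : Q.A) (x : PathDat Q × PathDat Q) :
    xL Q b (xR Q a x) = xR Q a (xL Q b x) := by
  simp [xL, xR, extL, extR]

end
end GentleTT

namespace GentleTT

/-! ### Cycles -/

def Cmp (Q : Quiv) (S : Set (Q.A × Q.A)) (p : PathDat Q) : Prop :=
  PG Q S p ∧ p.1 = ptgt Q p ∧ ∃ a b, p.2.head? = some a ∧ p.2.getLast? = some b ∧ (b, a) ∈ S

section
variable {Q : Quiv} {S : Set (Q.A × Q.A)}

theorem cmp_iff_sq (hc : ∀ {a b}, (a, b) ∈ S → Q.tgt a = Q.src b) (p : PathDat Q) :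
    IsCycle Q p ∧ PG Q S (powP Q p 2) ↔ Cmp Q S p := by
  obtain ⟨v, l⟩ := p
  unfold IsCycle Cmp Ok PG
  constructor
  · rintro ⟨⟨⟨h1, h2⟩, h3, h4⟩, h5, h6⟩
    simp only [powP, powL, List.append_nil] at h5 h6
    obtain ⟨a, ha⟩ := some_head h3
    obtain ⟨b, hb⟩ := some_last h3
    rw [List.isChain_append] at h5
    exact ⟨⟨h5.1, h2⟩, h4, a, b, ha, hb, h5.2.2 b hb a ha⟩
  · rintro ⟨⟨h1, h2⟩, h3, a, b, ha, hb, hab⟩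
    have hne : l ≠ [] := by rintro rfl; simp at ha
    refine ⟨⟨⟨h1.imp (fun _ _ h => hc h), h2⟩, hne, h3⟩, ?_, ?_⟩
    · simp only [powP, powL, List.append_nil]
      rw [List.isChain_append]
      refine ⟨h1, h1, ?_⟩
      intro x hx y hy
      simp only at ha hb
      rw [hb] at hx; rw [ha] at hy
      cases hx; cases hy; exact hab
    · simp only [powP, powL, List.append_nil]
      intro x hx
      apply h2 x
      simp only at ha ⊢
      rw [List.head?_append, ha] at hx
      rw [ha]; exact hx

theorem complete_iff (hc : ∀ {a b}, (a, b) ∈ S → Q.tgt a = Q.src b) (p : PathDat Q) :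
    Complete Q S p ↔ Cmp Q S p := by
  rw [← cmp_iff_sq hc, Complete, InG_iff hc]

theorem cocomplete_iff {R : Set (Q.A × Q.A)} (p : PathDat Q) :
    Cocomplete Q R p ↔ Cmp Q (cpl Q R) p := by
  rw [← cmp_iff_sq (fun h => h.1), Cocomplete, InB_iff]

open Classical in
noncomputable def nx (Q : Quiv) (S : Set (Q.A × Q.A)) (a : Q.A) : Q.A :=
  if h : ∃ b, (a, b) ∈ S then h.choose else a

theorem nx_eq (hf : ∀ {a b b'}, (a, b) ∈ S → (a, b') ∈ S → b = b') {a b : Q.A}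
    (h : (a, b) ∈ S) : nx Q S a = b := by
  have h' : ∃ b, (a, b) ∈ S := ⟨b, h⟩
  unfold nx
  rw [dif_pos h']
  exact hf h'.choose_spec h

noncomputable def cy (Q : Quiv) (S : Set (Q.A × Q.A)) (c : Q.A) (n : ℕ) : PathDat Q :=
  (Q.src c, List.iterate (nx Q S) c n)

def Gd (Q : Quiv) (S : Set (Q.A × Q.A)) (c : Q.A) (n : ℕ) : Prop :=
  1 ≤ n ∧ (nx Q S)^[n] c = c ∧ ∀ i, ((nx Q S)^[i] c, (nx Q S)^[i+1] c) ∈ S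

theorem chain_eq_iterate (hf : ∀ {a b b'}, (a, b) ∈ S → (a, b') ∈ S → b = b') :
    ∀ (l : List Q.A) (c : Q.A), (c :: l).IsChain (fun a b => (a, b) ∈ S) →
      c :: l = List.iterate (nx Q S) c (l.length + 1)
  | [], c, _ => by simp [List.iterate]
  | d :: l, c, h => by
    rw [List.isChain_cons_cons] at h
    have := chain_eq_iterate hf l d h.2
    rw [this]
    simp only [List.length_cons, List.iterate, nx_eq hf h.1]
    simp

theorem iterate_last (f : Q.A → Q.A) (c : Q.A) (n : ℕ) :
    (List.iterate f c (n+1)).getLast? = some (f^[n] c) := by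
  rw [List.iterate_add]
  simp [List.iterate]

theorem iterate_head (f : Q.A → Q.A) (c : Q.A) (n : ℕ) (hn : 1 ≤ n) :
    (List.iterate f c n).head? = some c := by
  obtain ⟨n, rfl⟩ := Nat.exists_eq_add_of_le' hn
  simp [List.iterate]

theorem cmp_iff_cy (hc : ∀ {a b}, (a, b) ∈ S → Q.tgt a = Q.src b)
    (hf : ∀ {a b b'}, (a, b) ∈ S → (a, b') ∈ S → b = b') (p : PathDat Q) :
    Cmp Q S p ↔ ∃ c n, Gd Q S c n ∧ p = cy Q S c n := by
  constructor
  · obtain ⟨v, l⟩ := p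
    rintro ⟨⟨h1, h2⟩, h3, a, b, ha, hb, hab⟩
    simp only at *
    cases l with
    | nil => simp at ha
    | cons c l =>
      simp at ha
      subst ha
      have hl := chain_eq_iterate hf l c h1
      have hv := h2 c (by simp)
      rw [hl, iterate_last] at hb
      simp at hb
      have hp : (nx Q S)^[l.length + 1] c = c := by
        rw [Function.iterate_succ_apply', hb, nx_eq hf hab]
      refine ⟨c, l.length + 1, ⟨by omega, hp, ?_⟩, ?_⟩
      · intro i
        have hper : Function.IsPeriodicPt (nx Q S) (l.length + 1) c := hp
        have e1 := hper.iterate_mod_apply i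
        have hlt : i % (l.length + 1) < l.length + 1 := Nat.mod_lt _ (by omega)
        rw [Function.iterate_succ_apply', ← e1]
        set j := i % (l.length+1) with hj
        by_cases hjl : j = l.length
        · rw [hjl, hb, nx_eq hf hab]; exact hab
        · rw [hl, List.isChain_iff_getElem] at h1
          have := h1 j (by simp; omega)
          simp only [List.getElem_iterate] at this
          rwa [Function.iterate_succ_apply'] at this
      · unfold cy; rw [hv, ← hl]
  · rintro ⟨c, n, ⟨hn, hp, hR⟩, rfl⟩
    obtain ⟨n, rfl⟩ := Nat.exists_eq_add_of_le' hn
    have h1 := hR n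
    rw [hp] at h1
    refine ⟨⟨?_, ?_⟩, ?_, c, (nx Q S)^[n] c, ?_, ?_, h1⟩
    · rw [List.isChain_iff_getElem]
      intro i hi
      simp only [cy, List.getElem_iterate]
      exact hR i
    · simp only [cy]
      rw [iterate_head _ _ _ hn]
      simp
    · simp only [cy, ptgt]
      rw [iterate_last]
      exact (hc h1).symm
    · simp only [cy]
      rw [iterate_head _ _ _ hn]
    · simp only [cy]
      rw [iterate_last]

theorem cy_inj {c c' : Q.A} {n n' : ℕ} (hn : 1 ≤ n) (h : cy Q S c n = cy Q S c' n') :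
    c = c' ∧ n = n' := by
  have h2 : List.iterate (nx Q S) c n = List.iterate (nx Q S) c' n' := congrArg Prod.snd h
  have h3 := congrArg List.length h2
  simp at h3
  subst h3
  have h4 := congrArg List.head? h2
  rw [iterate_head _ _ _ hn, iterate_head _ _ _ hn] at h4
  exact ⟨by simpa using h4, rfl⟩

theorem cy_pow {c : Q.A} {n : ℕ} (hp : (nx Q S)^[n] c = c) (k : ℕ) :
    powP Q (cy Q S c n) k = cy Q S c (n * k) := by
  unfold powP cy
  congr 1
  induction k with
  | zero => simp [powL, List.iterate]
  | succ k ih =>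
    simp only [powL]
    rw [ih, Nat.mul_succ, Nat.add_comm, List.iterate_add, hp]

theorem cy_rot {c : Q.A} {n : ℕ} (hn : 1 ≤ n) (hp : (nx Q S)^[n] c = c) :
    rotP Q (cy Q S (nx Q S c) n) = cy Q S c n := by
  obtain ⟨n, rfl⟩ := Nat.exists_eq_add_of_le' hn
  have e : (nx Q S)^[n] (nx Q S c) = c := by rw [← Function.iterate_succ_apply, hp]
  unfold rotP
  simp only [cy]
  rw [iterate_last, e]
  simp only [List.iterate]
  congr 2
  rw [← List.iterate, Nat.succ_eq_add_one, List.iterate_add]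
  simp [List.iterate]

theorem Gd.iter {c : Q.A} {n : ℕ} (h : Gd Q S c n) (j : ℕ) : Gd Q S ((nx Q S)^[j] c) n := by
  refine ⟨h.1, ?_, fun i => ?_⟩
  · rw [← Function.iterate_add_apply, Nat.add_comm, Function.iterate_add_apply, h.2.1]
  · rw [← Function.iterate_add_apply, ← Function.iterate_add_apply]
    have := h.2.2 (i + j)
    rwa [show i + 1 + j = i + j + 1 by omega]

theorem Gd.mp_pos {c : Q.A} {n : ℕ} (h : Gd Q S c n) :
    0 < Function.minimalPeriod (nx Q S) c :=
  Function.IsPeriodicPt.minimalPeriod_pos h.1 h.2.1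

theorem Gd.mp_dvd {c : Q.A} {n : ℕ} (h : Gd Q S c n) :
    Function.minimalPeriod (nx Q S) c ∣ n :=
  Function.IsPeriodicPt.minimalPeriod_dvd h.2.1

theorem Gd.mp {c : Q.A} {n : ℕ} (h : Gd Q S c n) :
    Gd Q S c (Function.minimalPeriod (nx Q S) c) :=
  ⟨h.mp_pos, Function.iterate_minimalPeriod, h.2.2⟩

theorem Gd.mp_iter {c : Q.A} {n : ℕ} (h : Gd Q S c n) (j : ℕ) :
    Function.minimalPeriod (nx Q S) ((nx Q S)^[j] c) = Function.minimalPeriod (nx Q S) c :=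
  Function.minimalPeriod_apply_iterate (Function.mk_mem_periodicPts h.1 h.2.1) j

theorem cy_rotI {c : Q.A} {n : ℕ} (h : Gd Q S c n) (i : ℕ) :
    rotI Q i (cy Q S c n) =
      cy Q S ((nx Q S)^[(Function.minimalPeriod (nx Q S) c - 1) * i] c) n := by
  induction i with
  | zero => simp [rotI]
  | succ i ih =>
    unfold rotI at *
    rw [Function.iterate_succ_apply', ih]
    set r := Function.minimalPeriod (nx Q S) c
    have hr : 0 < r := h.mp_pos
    have e : (nx Q S)^[(r-1) * i] c = nx Q S ((nx Q S)^[(r-1)*(i+1)] c) := by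
      rw [← Function.iterate_succ_apply' (nx Q S), Nat.mul_succ,
        show ((r-1)*i + (r-1)).succ = (r-1)*i + r by omega,
        Function.iterate_add_apply, Function.iterate_minimalPeriod]
    rw [e]
    exact cy_rot h.1 (h.iter _).2.1

theorem rotI_len {p : PathDat Q} (h : Cmp Q S p) (hc : ∀ {a b}, (a, b) ∈ S → Q.tgt a = Q.src b)
    (hf : ∀ {a b b'}, (a, b) ∈ S → (a, b') ∈ S → b = b') : rotI Q p.2.length p = p := by
  obtain ⟨c, n, hcn, rfl⟩ := (cmp_iff_cy hc hf _).1 h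
  rw [cy_rotI hcn]
  simp only [cy, List.length_iterate]
  have : (nx Q S)^[(Function.minimalPeriod (nx Q S) c - 1) * n] c = c :=
    Function.IsPeriodicPt.const_mul hcn.2.1 _
  rw [this]

theorem rotI_cmp {p : PathDat Q} (h : Cmp Q S p) (hc : ∀ {a b}, (a, b) ∈ S → Q.tgt a = Q.src b)
    (hf : ∀ {a b b'}, (a, b) ∈ S → (a, b') ∈ S → b = b') (i : ℕ) :
    Cmp Q S (rotI Q i p) ∧ (rotI Q i p).2.length = p.2.length := by
  obtain ⟨c, n, hcn, rfl⟩ := (cmp_iff_cy hc hf _).1 h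
  rw [cy_rotI hcn]
  exact ⟨(cmp_iff_cy hc hf _).2 ⟨_, _, hcn.iter _, rfl⟩, by simp [cy]⟩

theorem periodP_eq (p : PathDat Q) (h : p ∈ Function.periodicPts (rotP Q)) :
    periodP Q p = Function.minimalPeriod (rotP Q) p := by
  unfold periodP rotI
  have hpos := Function.minimalPeriod_pos_of_mem_periodicPts h
  apply le_antisymm
  · exact Nat.sInf_le ⟨hpos, Function.iterate_minimalPeriod⟩
  · have := Nat.sInf_mem (s := {i : ℕ | 1 ≤ i ∧ (rotP Q)^[i] p = p})
      ⟨_, hpos, Function.iterate_minimalPeriod⟩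
    exact Function.IsPeriodicPt.minimalPeriod_le this.1 this.2

theorem isCycle_of_cmp {p : PathDat Q} (hc : ∀ {a b}, (a, b) ∈ S → Q.tgt a = Q.src b) (h : Cmp Q S p) :
    IsCycle Q p := ((cmp_iff_sq hc p).2 h).1

theorem powL_len {α : Type} (l : List α) (n : ℕ) : (powL l n).length = n * l.length := by
  induction n with
  | zero => simp [powL]
  | succ n ih => simp [powL, ih, Nat.succ_mul, Nat.add_comm]

theorem cmp_of_pow (hc : ∀ {a b}, (a, b) ∈ S → Q.tgt a = Q.src b) {q : PathDat Q} {n : ℕ}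
    (hn : 2 ≤ n) (hq : IsCycle Q q) (h : PG Q S (powP Q q n)) : Cmp Q S q := by
  rw [← cmp_iff_sq hc]
  refine ⟨hq, ?_, ?_⟩
  · obtain ⟨n, rfl⟩ := Nat.exists_eq_add_of_le' hn
    have := h.1
    simp only [powP, powL, List.append_nil] at this ⊢
    rw [← List.append_assoc] at this
    exact this.left_of_append
  · intro a ha
    simp only [powP, powL, List.append_nil] at ha ⊢
    apply hq.1.2 a
    obtain ⟨b, hb⟩ := some_head hq.2.1
    rw [List.head?_append, hb] at ha
    rw [hb]; exact ha

theorem prim_iff (hc : ∀ {a b}, (a, b) ∈ S → Q.tgt a = Q.src b)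
    (hf : ∀ {a b b'}, (a, b) ∈ S → (a, b') ∈ S → b = b') {c : Q.A} {n : ℕ} (h : Gd Q S c n) :
    IsPrimitive Q (cy Q S c n) ↔ n = Function.minimalPeriod (nx Q S) c := by
  constructor
  · rintro ⟨_, h2⟩
    obtain ⟨k, hk⟩ := h.mp_dvd
    by_contra hne
    apply h2 (cy Q S c (Function.minimalPeriod (nx Q S) c)) k
    · exact isCycle_of_cmp hc ((cmp_iff_cy hc hf _).2 ⟨_, _, h.mp, rfl⟩)
    · rcases k with _ | _ | k
      · have := h.1; omega
      · simp at hk; exact absurd hk hne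
      · omega
    · rw [cy_pow Function.iterate_minimalPeriod, ← hk]
  · intro hn
    have hC : Cmp Q S (cy Q S c n) := (cmp_iff_cy hc hf _).2 ⟨_, _, h, rfl⟩
    refine ⟨isCycle_of_cmp hc hC, ?_⟩
    intro q k hq hk e
    have hq' : Cmp Q S q := cmp_of_pow hc hk hq (e ▸ hC.1)
    obtain ⟨c', l, hl, rfl⟩ := (cmp_iff_cy hc hf _).1 hq'
    rw [cy_pow hl.2.1] at e
    obtain ⟨rfl, e2⟩ := cy_inj h.1 e
    have := Nat.le_of_dvd hl.1 hl.mp_dvd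
    rw [← hn, e2] at this
    have := hl.1
    nlinarith

/-- The properties of a system of representatives we use. -/
structure RepSys (Q : Quiv) (S : Set (Q.A × Q.A)) (Sb : Set (PathDat Q)) : Prop where
  cmp : ∀ p ∈ Sb, Cmp Q S p
  ex : ∀ p, Cmp Q S p → ∃ p0 ∈ Sb, ∃ i, rotI Q i p0 = p
  uniq : ∀ p ∈ Sb, ∀ q ∈ Sb, ∀ i, rotI Q i p = q → p = q

theorem rotI_symm (hc : ∀ {a b}, (a, b) ∈ S → Q.tgt a = Q.src b)
    (hf : ∀ {a b b'}, (a, b) ∈ S → (a, b') ∈ S → b = b') {p q : PathDat Q} (h : Cmp Q S p)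
    {i : ℕ} (e : rotI Q i p = q) : ∃ j, rotI Q j q = p := by
  have h1 := rotI_len h hc hf
  have hpos : 1 ≤ p.2.length := by
    obtain ⟨_, _, a, b, ha, _⟩ := h
    cases hp : p.2 with
    | nil => simp [hp] at ha
    | cons => simp
  refine ⟨(p.2.length - 1) * i, ?_⟩
  rw [← e]
  unfold rotI at *
  rw [← Function.iterate_add_apply]
  have : (p.2.length - 1) * i + i = p.2.length * i := by
    obtain ⟨k, hk⟩ := Nat.exists_eq_add_of_le' hpos
    rw [hk]; simp; ring
  rw [this]
  exact Function.IsPeriodicPt.mul_const (f := rotP Q) h1 i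

theorem repSys (hc : ∀ {a b}, (a, b) ∈ S → Q.tgt a = Q.src b)
    (hf : ∀ {a b b'}, (a, b) ∈ S → (a, b') ∈ S → b = b') {Sb : Set (PathDat Q)}
    {Pred : PathDat Q → Prop} (hP : ∀ p, Pred p ↔ Cmp Q S p) (h : IsCrep Q Sb Pred) :
    RepSys Q S Sb := by
  obtain ⟨P, ⟨hP1, hP2⟩, rfl⟩ := h
  have key : ∀ p ∈ P, ∃ c, Gd Q S c (Function.minimalPeriod (nx Q S) c) ∧
      p = cy Q S c (Function.minimalPeriod (nx Q S) c) := by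
    intro p hp
    obtain ⟨h1, h2⟩ := hP1 p hp
    obtain ⟨c, n, hcn, rfl⟩ := (cmp_iff_cy hc hf _).1 ((hP _).1 h2)
    have := (prim_iff hc hf hcn).1 h1
    exact ⟨c, hcn.mp, by rw [← this]⟩
  refine ⟨?_, ?_, ?_⟩
  · rintro _ ⟨p, hp, n, hn, rfl⟩
    obtain ⟨c, hc1, rfl⟩ := key p hp
    rw [cy_pow hc1.2.1]
    refine (cmp_iff_cy hc hf _).2 ⟨_, _, ⟨?_, ?_, hc1.2.2⟩, rfl⟩
    · exact Nat.mul_pos hc1.1 hn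
    · exact Function.IsPeriodicPt.mul_const (f := nx Q S) hc1.2.1 n
  · intro p hp
    obtain ⟨c, n, hcn, rfl⟩ := (cmp_iff_cy hc hf _).1 hp
    have hprim : IsPrimitive Q (cy Q S c (Function.minimalPeriod (nx Q S) c)) :=
      (prim_iff hc hf hcn.mp).2 rfl
    have hcm := (hP _).2 ((cmp_iff_cy hc hf _).2 ⟨_, _, hcn.mp, rfl⟩)
    obtain ⟨p', ⟨hp', i, hi⟩, _⟩ := hP2 _ ⟨hprim, hcm⟩
    obtain ⟨k, hk⟩ := hcn.mp_dvd
    have hk1 : 1 ≤ k := by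
      rcases k with _ | k
      · have := hcn.1; omega
      · omega
    rw [cy_rotI hcn.mp] at hi
    have e : powP Q p' k = rotI Q i (cy Q S c n) := by
      rw [← hi, cy_rotI hcn, cy_pow (hcn.mp.iter _).2.1, ← hk]
    obtain ⟨j, hj⟩ := rotI_symm hc hf hp e.symm
    exact ⟨_, ⟨p', hp', k, hk1, rfl⟩, j, hj⟩
  · rintro _ ⟨p, hp, n, hn, rfl⟩ _ ⟨q, hq, l, hl, rfl⟩ i hi
    obtain ⟨c, hc1, rfl⟩ := key p hp
    obtain ⟨c', hc2, rfl⟩ := key q hq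
    rw [cy_pow hc1.2.1, cy_pow hc2.2.1] at *
    have hgd : Gd Q S c (Function.minimalPeriod (nx Q S) c * n) :=
      ⟨Nat.mul_pos hc1.1 hn, Function.IsPeriodicPt.mul_const (f := nx Q S) hc1.2.1 n, hc1.2.2⟩
    rw [cy_rotI hgd] at hi
    obtain ⟨e1, e2⟩ := cy_inj hgd.1 hi
    have e3 := hc1.mp_iter ((Function.minimalPeriod (nx Q S) c - 1) * i)
    rw [e1] at e3
    obtain ⟨s, _, hs⟩ := hP2 _ (hP1 _ hp)
    have t1 := hs _ ⟨hp, 0, rfl⟩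
    have t2 := hs _ ⟨hq, i, by rw [cy_rotI hc1, e1, e3]⟩
    obtain ⟨rfl, -⟩ := cy_inj hc1.1 (t1.trans t2.symm)
    rw [e2]

end
end GentleTT

namespace GentleTT

/-! ### Classification of parallel pairs -/

section
variable {Q : Quiv} {S S' : Set (Q.A × Q.A)}

def Core (Q : Quiv) (S S' : Set (Q.A × Q.A)) (x : PathDat Q × PathDat Q) : Prop :=
  Mem Q S S' x ∧ ¬ hEq x ∧ ¬ lEq x ∧ ¬ (x.1.2 = [] ∧ Cmp Q S' x.2) ∧
    ¬ (x.2.2 = [] ∧ Cmp Q S x.1)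

theorem Core.swap {x : PathDat Q × PathDat Q} (h : Core Q S S' x) : Core Q S' S x.swap :=
  ⟨h.1.swap, fun e => h.2.1 (Eq.symm e), fun e => h.2.2.1 (Eq.symm e), h.2.2.2.2, h.2.2.2.1⟩

theorem Core.not_triv {x : PathDat Q × PathDat Q} (h : Core Q S S' x) : ¬ Triv x := by
  rintro ⟨h1, h2⟩
  apply h.2.1
  simp [hEq, h1, h2]

theorem nil_case (hg : Gtl Q S S') {x : PathDat Q × PathDat Q} (h : Mem Q S S' x)
    (h1 : x.1.2 = []) (h2 : x.2.2 ≠ []) (h3 : ¬ Cmp Q S' x.2) :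
    ∃ c d, x.2.2.getLast? = some c ∧ x.2.2.head? = some d ∧ (c, d) ∈ S := by
  obtain ⟨c, hc⟩ := some_last h2
  obtain ⟨d, hd⟩ := some_head h2
  refine ⟨c, d, hc, hd, ?_⟩
  obtain ⟨m1, m2, m3, m4⟩ := h
  unfold psrc at m3
  have e1 : x.2.1 = ptgt Q x.2 := by
    rw [← m3, ← m4, ptgt_nil _ h1]
  have e2 := m2.2 d hd
  rw [ptgt_last _ hc] at e1
  rcases hg.tot (e1.symm.trans e2.symm) with h | h
  · exact h
  · exact absurd ⟨m2, by rw [ptgt_last _ hc]; exact e1, d, c, hd, hc, h⟩ h3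

theorem last_cons (a : Q.A) {l : List Q.A} (h : l ≠ []) :
    (a :: l).getLast? = l.getLast? := by
  obtain ⟨c, hc⟩ := some_last h
  rw [List.getLast?_cons, hc]; simp

theorem head_snoc (a : Q.A) {l : List Q.A} (h : l ≠ []) :
    (l ++ [a]).head? = l.head? := by
  obtain ⟨c, hc⟩ := some_head h
  rw [List.head?_append, hc]; simp

theorem core_nil (hg : Gtl Q S S') {x : PathDat Q × PathDat Q} (h : Core Q S S' x)
    (h1 : x.1.2 = []) {b : Q.A} (hb : Lc Q S S' b x) :
    ¬ hEq (xL Q b x) ∧ ∀ a, Rc Q S S' a x → (a, b) ∈ S := by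
  have h2 : x.2.2 ≠ [] := fun e => h.not_triv ⟨h1, e⟩
  obtain ⟨c, d, hc, hd, hcd⟩ := nil_case hg h.1 h1 h2 (fun e => h.2.2.2.1 ⟨h1, e⟩)
  have hcb := hb.2.2 c hc
  constructor
  · intro e
    simp only [hEq, xL, extL, h1] at e
    rw [head_snoc _ h2, hd] at e
    simp at e
    subst e
    exact hg.excl hcd hcb
  · intro a ha
    have had := ha.2.2 d hd
    have : Q.tgt a = Q.src b := by rw [ha.1, hb.1, ptgt_nil _ h1]
    rcases hg.tot this with h | h
    · exact h
    · have := hg.bwd' h hcb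
      subst this
      exact absurd had (fun e => hg.excl hcd e)

theorem core_nilR (hg : Gtl Q S S') {x : PathDat Q × PathDat Q} (h : Core Q S S' x)
    (h1 : x.1.2 = []) {a : Q.A} (ha : Rc Q S S' a x) :
    ¬ lEq (xR Q a x) := by
  have h2 : x.2.2 ≠ [] := fun e => h.not_triv ⟨h1, e⟩
  obtain ⟨c, d, hc, hd, hcd⟩ := nil_case hg h.1 h1 h2 (fun e => h.2.2.2.1 ⟨h1, e⟩)
  have had := ha.2.2 d hd
  intro e
  simp only [lEq, xR, extR, h1] at e
  rw [last_cons _ h2, hc] at e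
  simp at e
  subst e
  exact hg.excl hcd had

theorem core_L_hEq (hg : Gtl Q S S') {x : PathDat Q × PathDat Q} (h : Core Q S S' x)
    {b : Q.A} (hb : Lc Q S S' b x) : ¬ hEq (xL Q b x) := by
  by_cases h1 : x.1.2 = []
  · exact (core_nil hg h h1 hb).1
  by_cases h2 : x.2.2 = []
  · have := (core_nil hg.swap h.swap h2 (hb.swap h.1)).1
    intro e; exact this (Eq.symm e)
  · intro e
    apply h.2.1
    simp only [hEq, xL, extL] at *
    rwa [head_snoc _ h1, head_snoc _ h2] at e

theorem core_R_lEq (hg : Gtl Q S S') {x : PathDat Q × PathDat Q} (h : Core Q S S' x)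
    {a : Q.A} (ha : Rc Q S S' a x) : ¬ lEq (xR Q a x) := by
  by_cases h1 : x.1.2 = []
  · exact core_nilR hg h h1 ha
  by_cases h2 : x.2.2 = []
  · have := core_nilR hg.swap h.swap h2 (ha.swap h.1)
    intro e; exact this (Eq.symm e)
  · intro e
    apply h.2.2.1
    simp only [lEq, xR, extR] at *
    rwa [last_cons _ h1, last_cons _ h2] at e

theorem core_ab (hg : Gtl Q S S') {x : PathDat Q × PathDat Q} (h : Core Q S S' x)
    {a b : Q.A} (hb : Lc Q S S' b x) (ha : Rc Q S S' a x) :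
    (x.1.2 = [] → (a, b) ∈ S) ∧ (x.2.2 = [] → (a, b) ∈ S') :=
  ⟨fun h1 => (core_nil hg h h1 hb).2 a ha,
    fun h2 => (core_nil hg.swap h.swap h2 (hb.swap h.1)).2 a (ha.swap h.1)⟩

theorem core_LR (hg : Gtl Q S S') {x : PathDat Q × PathDat Q} (h : Core Q S S' x)
    {a b : Q.A} (hb : Lc Q S S' b x) (ha : Rc Q S S' a x) : Lc Q S S' b (xR Q a x) := by
  obtain ⟨h1, h2⟩ := core_ab hg h hb ha
  refine ⟨?_, ?_, ?_⟩
  · simp only [xR]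
    rw [ptgt_extR _ _ ha.1]
    exact hb.1
  · simp only [xR, extR]
    intro c hc
    by_cases e : x.1.2 = []
    · rw [e] at hc
      simp at hc
      subst hc; exact h1 e
    · rw [last_cons _ e] at hc
      exact hb.2.1 c hc
  · simp only [xR, extR]
    intro c hc
    by_cases e : x.2.2 = []
    · rw [e] at hc
      simp at hc
      subst hc; exact h2 e
    · rw [last_cons _ e] at hc
      exact hb.2.2 c hc

theorem core_RL (hg : Gtl Q S S') {x : PathDat Q × PathDat Q} (h : Core Q S S' x)
    {a b : Q.A} (hb : Lc Q S S' b x) (ha : Rc Q S S' a x) : Rc Q S S' a (xL Q b x) := by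
  have h1 := core_LR hg h hb ha
  have hx : x.1.1 = x.2.1 := h.1.2.2.1
  have h2 : Mem Q S S' (xL Q b (xR Q a x)) :=
    (mem_xL hg _ _).2 ⟨(mem_xR hg _ _ ha.1 hx).2 ⟨h.1, ha⟩, h1⟩
  rw [xL_xR] at h2
  exact ((mem_xR hg _ _ (by simpa [xL, extL] using ha.1) (by simpa [xL, extL] using hx)).1 h2).2

theorem Lc_of_xR {x : PathDat Q × PathDat Q} {a b : Q.A} (ha : Q.tgt a = x.1.1)
    (h : Lc Q S S' b (xR Q a x)) : Lc Q S S' b x := by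
  obtain ⟨h1, h2, h3⟩ := h
  simp only [xR] at h1 h2 h3
  rw [ptgt_extR _ _ ha] at h1
  refine ⟨h1, fun c hc => h2 c ?_, fun c hc => h3 c ?_⟩
  · have : x.1.2 ≠ [] := by intro e; simp [e] at hc
    simp only [extR]; rwa [last_cons _ this]
  · have : x.2.2 ≠ [] := by intro e; simp [e] at hc
    simp only [extR]; rwa [last_cons _ this]

theorem Rc_of_xL {x : PathDat Q × PathDat Q} {a b : Q.A}
    (h : Rc Q S S' a (xL Q b x)) : Rc Q S S' a x := by
  obtain ⟨h1, h2, h3⟩ := h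
  simp only [xL] at h1 h2 h3
  refine ⟨h1, fun c hc => h2 c ?_, fun c hc => h3 c ?_⟩
  · have : x.1.2 ≠ [] := by intro e; simp [e] at hc
    simp only [extL]; rwa [head_snoc _ this]
  · have : x.2.2 ≠ [] := by intro e; simp [e] at hc
    simp only [extL]; rwa [head_snoc _ this]

def ini (x : PathDat Q × PathDat Q) : PathDat Q × PathDat Q :=
  ((x.1.1, x.1.2.dropLast), (x.2.1, x.2.2.dropLast))

def tl (x : PathDat Q × PathDat Q) : PathDat Q × PathDat Q := (r1P Q x.1, r1P Q x.2)

@[simp] theorem ini_xL (b : Q.A) (x : PathDat Q × PathDat Q) : ini (xL Q b x) = x := by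
  simp [ini, xL, extL]

theorem tl_xR (a : Q.A) (x : PathDat Q × PathDat Q) (h : Q.tgt a = x.1.1)
    (h' : x.1.1 = x.2.1) : tl (xR Q a x) = x := by
  simp only [tl, xR, extR, r1P]
  rw [h]
  conv_lhs => rw [show (x.1.1, x.2.2) = (x.2.1, x.2.2) by rw [h']]

theorem exists_xL {x : PathDat Q × PathDat Q} (ht : ¬ Triv x) (hl : lEq x) :
    ∃ b y, x = xL Q b y := by
  obtain ⟨⟨v, l⟩, w, l'⟩ := x
  rcases List.eq_nil_or_concat l with rfl | ⟨l1, c, rfl⟩ <;>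
  rcases List.eq_nil_or_concat l' with rfl | ⟨l2, d, rfl⟩
  · exact absurd ⟨rfl, rfl⟩ ht
  · simp [lEq] at hl
  · simp [lEq] at hl
  · simp [lEq] at hl
    subst hl
    exact ⟨c, ((v, l1), (w, l2)), by simp [xL, extL]⟩

theorem exists_xR (hg : Gtl Q S S') {x : PathDat Q × PathDat Q} (ht : ¬ Triv x) (hl : hEq x)
    (hm : Mem Q S S' x) : ∃ a y, Mem Q S S' y ∧ Rc Q S S' a y ∧ x = xR Q a y := by
  obtain ⟨⟨v, l⟩, w, l'⟩ := x
  rcases l with _ | ⟨c, l1⟩ <;> rcases l' with _ | ⟨d, l2⟩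
  · exact absurd ⟨rfl, rfl⟩ ht
  · simp [hEq] at hl
  · simp [hEq] at hl
  · simp [hEq] at hl
    subst hl
    have e1 := hm.1.2 c (by simp)
    have e2 := hm.2.1.2 c (by simp)
    simp only at e1 e2
    have e : (((v, c :: l1), (w, c :: l2)) : PathDat Q × PathDat Q) =
        xR Q c ((Q.tgt c, l1), (Q.tgt c, l2)) := by simp [xR, extR, ← e1, ← e2]
    refine ⟨c, ((Q.tgt c, l1), (Q.tgt c, l2)), ?_⟩
    rw [e] at hm
    rw [mem_xR hg _ _ rfl rfl] at hm
    exact ⟨hm.1, hm.2, e⟩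

theorem lEq_xR (a : Q.A) {x : PathDat Q × PathDat Q} (h : lEq x) : lEq (xR Q a x) := by
  unfold lEq at *
  simp only [xR, extR, List.getLast?_cons, h]

theorem hEq_xL (a : Q.A) {x : PathDat Q × PathDat Q} (h : hEq x) : hEq (xL Q a x) := by
  unfold hEq at *
  simp only [xL, extL, List.head?_append, h]

/-- Cyclic pairs. -/
theorem cyc_Lc (hg : Gtl Q S S') {x : PathDat Q × PathDat Q} (hm : Mem Q S S' x)
    (h1 : x.1.2 = []) (h2 : Cmp Q S' x.2) :
    ∃ c d, x.2.2.head? = some c ∧ x.2.2.getLast? = some d ∧ (d, c) ∈ S' ∧ 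
      Lc Q S S' c x ∧ Rc Q S S' d x := by
  obtain ⟨h3, h4, c, d, hc, hd, hdc⟩ := h2
  refine ⟨c, d, hc, hd, hdc, ⟨?_, ?_, ?_⟩, ?_, ?_, ?_⟩
  · rw [hm.2.2.2, ptgt_last _ hd, hg.comp' hdc]
  · simp [h1]
  · rw [hd]; rintro _ ⟨⟩; exact hdc
  · have : x.1.1 = x.2.1 := hm.2.2.1
    rw [this, h4, ptgt_last _ hd]
  · simp [h1]
  · rw [hc]; rintro _ ⟨⟩; exact hdc

theorem nil_form {x : PathDat Q × PathDat Q} (hm : Mem Q S S' x)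
    (h1 : x.1.2 = []) : x = ((x.2.1, []), x.2) := by
  have : x.1.1 = x.2.1 := hm.2.2.1
  rw [← this, ← h1]

theorem mem_cyc {p : PathDat Q} (h : Cmp Q S' p) : Mem Q S S' ((p.1, []), p) :=
  ⟨⟨by simp, by simp⟩, h.1, rfl, by rw [← h.2.1]; simp [ptgt]⟩

theorem cmp_ne {p : PathDat Q} (h : Cmp Q S p) : p.2 ≠ [] := by
  obtain ⟨_, _, a, b, ha, _⟩ := h
  intro e; simp [e] at ha

/-- The trichotomy for pairs with different beginnings and ends. -/
theorem core_or {x : PathDat Q × PathDat Q} (hm : Mem Q S S' x) (h1 : ¬ hEq x)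
    (h2 : ¬ lEq x) : Core Q S S' x ∨ (x.1.2 = [] ∧ Cmp Q S' x.2) ∨ (x.2.2 = [] ∧ Cmp Q S x.1) := by
  unfold Core; tauto

inductive Cls (Q : Quiv) (S S' : Set (Q.A × Q.A)) : PathDat Q × PathDat Q → Prop
  | vtx (v : Q.V) : Cls Q S S' ((v, []), (v, []))
  | arr (a : Q.A) : Cls Q S S' ((Q.src a, [a]), (Q.src a, [a]))
  | cycB (p : PathDat Q) (h : Cmp Q S' p) : Cls Q S S' ((p.1, []), p)
  | cycG (p : PathDat Q) (h : Cmp Q S p) : Cls Q S S' (p, (p.1, []))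
  | core (x : PathDat Q × PathDat Q) (h : Core Q S S' x) : Cls Q S S' x
  | coreL (x : PathDat Q × PathDat Q) (h : Core Q S S' x) (b : Q.A) (hb : Lc Q S S' b x) :
      Cls Q S S' (xL Q b x)
  | coreR (x : PathDat Q × PathDat Q) (h : Core Q S S' x) (a : Q.A) (ha : Rc Q S S' a x) :
      Cls Q S S' (xR Q a x)
  | coreLR (x : PathDat Q × PathDat Q) (h : Core Q S S' x) (a b : Q.A) (hb : Lc Q S S' b x)
      (ha : Rc Q S S' a x) : Cls Q S S' (xL Q b (xR Q a x))
  | cycB' (p : PathDat Q) (h : Cmp Q S' p) (c : Q.A) (hc : p.2.head? = some c) :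
      Cls Q S S' (xL Q c ((p.1, []), p))
  | cycG' (p : PathDat Q) (h : Cmp Q S p) (c : Q.A) (hc : p.2.head? = some c) :
      Cls Q S S' (xL Q c (p, (p.1, [])))

theorem classify (hg : Gtl Q S S') {w : PathDat Q × PathDat Q} (hm : Mem Q S S' w) :
    Cls Q S S' w := by
  by_cases ht : Triv w
  · rw [nil_form hm ht.1]
    obtain ⟨⟨v, l⟩, v', l'⟩ := w
    obtain ⟨rfl, rfl⟩ : l = [] ∧ l' = [] := ht
    exact Cls.vtx v'
  by_cases hl : lEq w
  · obtain ⟨b, x, rfl⟩ := exists_xL ht hl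
    obtain ⟨hx, hb⟩ := (mem_xL hg _ _).1 hm
    by_cases hxt : Triv x
    · have e := nil_form hx hxt.1
      obtain ⟨⟨v, l⟩, v', l'⟩ := x
      obtain ⟨rfl, rfl⟩ : l = [] ∧ l' = [] := hxt
      have e1 := hb.1
      simp [ptgt] at e1
      simp at e
      subst e e1
      exact Cls.arr b
    have hxl : ¬ lEq x := fun e => no_Lc hg hxt e hb
    by_cases hxh : hEq x
    · obtain ⟨a, y, hy, ha, rfl⟩ := exists_xR hg hxt hxh hx
      have hb' := Lc_of_xR ha.1 hb
      by_cases hyt : Triv y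
      · exfalso
        refine hg.excl (hb.2.1 a ?_) (hb.2.2 a ?_)
        · simp [xR, extR, hyt.1]
        · simp [xR, extR, hyt.2]
      have hyh : ¬ hEq y := fun e => no_Rc hg hyt e ha
      have hyl : ¬ lEq y := fun e => hxl (lEq_xR a e)
      rcases core_or hy hyh hyl with h | ⟨h1, h2⟩ | ⟨h1, h2⟩
      · exact Cls.coreLR y h a b hb' ha
      · exfalso
        obtain ⟨c, d, _, _, hdc, hL, hR⟩ := cyc_Lc hg hy h1 h2
        have e1 := Lc_unique hg hyt hb' hL
        have e2 := Rc_unique hg hyt ha hR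
        subst e1 e2
        exact hg.excl (hb.2.1 a (by simp [xR, extR, h1])) hdc
      · exfalso
        have hyt' : ¬ Triv y.swap := fun e => hyt ⟨e.2, e.1⟩
        obtain ⟨c, d, _, _, hdc, hL, hR⟩ := cyc_Lc hg.swap hy.swap h1 h2
        have e1 := Lc_unique hg.swap hyt' (hb'.swap hy) hL
        have e2 := Rc_unique hg.swap hyt' (ha.swap hy) hR
        subst e1 e2
        exact hg.excl hdc (hb.2.2 a (by simp [xR, extR, h1]))
    · rcases core_or hx hxh hxl with h | ⟨h1, h2⟩ | ⟨h1, h2⟩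
      · exact Cls.coreL x h b hb
      · obtain ⟨c, d, hc, _, hdc, hL, hR⟩ := cyc_Lc hg hx h1 h2
        have e1 := Lc_unique hg hxt hb hL
        subst e1
        rw [nil_form hx h1]
        exact Cls.cycB' _ h2 b hc
      · have hxt' : ¬ Triv x.swap := fun e => hxt ⟨e.2, e.1⟩
        obtain ⟨c, d, hc, _, hdc, hL, hR⟩ := cyc_Lc hg.swap hx.swap h1 h2
        have e1 := Lc_unique hg.swap hxt' (hb.swap hx) hL
        subst e1
        have e2 := congrArg Prod.swap (nil_form hx.swap h1)
        simp at e2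
        rw [e2]
        exact Cls.cycG' _ h2 b hc
  · by_cases hh : hEq w
    · obtain ⟨a, x, hx, ha, rfl⟩ := exists_xR hg ht hh hm
      have hxt : ¬ Triv x := fun e => hl (by simp [lEq, xR, extR, e.1, e.2])
      have hxh : ¬ hEq x := fun e => no_Rc hg hxt e ha
      have hxl : ¬ lEq x := fun e => hl (lEq_xR a e)
      rcases core_or hx hxh hxl with h | ⟨h1, h2⟩ | ⟨h1, h2⟩
      · exact Cls.coreR x h a ha
      · exfalso
        obtain ⟨c, d, hc, hd, hdc, hL, hR⟩ := cyc_Lc hg hx h1 h2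
        have e2 := Rc_unique hg hxt ha hR
        subst e2
        apply hl
        simp [lEq, xR, extR, h1, List.getLast?_cons, hd]
      · exfalso
        have hxt' : ¬ Triv x.swap := fun e => hxt ⟨e.2, e.1⟩
        obtain ⟨c, d, hc, hd, hdc, hL, hR⟩ := cyc_Lc hg.swap hx.swap h1 h2
        have e2 := Rc_unique hg.swap hxt' (ha.swap hx) hR
        subst e2
        apply hl
        simp at hd
        simp [lEq, xR, extR, h1, List.getLast?_cons, hd]
    · rcases core_or hm hh hl with h | ⟨h1, h2⟩ | ⟨h1, h2⟩
      · exact Cls.core _ h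
      · rw [nil_form hm h1]
        exact Cls.cycB _ h2
      · have e2 := congrArg Prod.swap (nil_form hm.swap h1)
        simp at e2
        rw [e2]
        exact Cls.cycG _ h2

end
end GentleTT

namespace GentleTT

/-! ### The differential and the contracting homotopy on basis elements -/

section
variable {k : Type} [Field k] {Q : Quiv} {R : Set (Q.A × Q.A)}

theorem bv_of {m : ℕ} {x : PathDat Q × PathDat Q} (h : GBmem Q R m x) :
    bv k Q R m x = Finsupp.single (⟨x, h⟩ : GB Q R m) (1 : k) := by
  unfold bv
  rw [dif_pos h]

theorem bv_not {m : ℕ} {x : PathDat Q × PathDat Q} (h : ¬ GBmem Q R m x) :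
    bv k Q R m x = 0 := by
  unfold bv
  rw [dif_neg h]

variable (k R) in
noncomputable def dL (m : ℕ) (x : PathDat Q × PathDat Q) : Coch k Q R (m + 1) :=
  ∑ b : Q.A, bv k Q R (m + 1) (xL Q b x)

open Classical in
variable (k R) in
noncomputable def dR (m : ℕ) (x : PathDat Q × PathDat Q) : Coch k Q R (m + 1) :=
  ∑ a : Q.A, if Q.tgt a = x.1.1 then bv k Q R (m + 1) (xR Q a x) else 0

theorem d_bv {m : ℕ} {x : PathDat Q × PathDat Q} (h : GBmem Q R m x) :
    dLin k Q R m (bv k Q R m x) = dL k R m x - (-1 : k) ^ m • dR k R m x := by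
  rw [bv_of h]
  unfold dLin
  rw [Finsupp.linearCombination_single, one_smul]
  unfold dB dL dR
  congr 2
  apply Finset.sum_congr rfl
  intro a _
  by_cases h1 : Q.tgt a = x.1.1
  · rw [if_pos h1]
    unfold bv xR
    by_cases h2 : GBmem Q R (m + 1) (extR Q a x.1, extR Q a x.2)
    · rw [dif_pos h2, dif_pos ⟨h1, h2⟩]
    · rw [dif_neg h2, dif_neg (fun h => h2 h.2)]
  · rw [if_neg h1, dif_neg (fun h => h1 h.1)]

theorem gb_xL (hg : Gtl Q R (cpl Q R)) {m : ℕ} {x : PathDat Q × PathDat Q} {b : Q.A} :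
    GBmem Q R (m + 1) (xL Q b x) ↔ GBmem Q R m x ∧ Lc Q R (cpl Q R) b x := by
  rw [GBmem_iff hg, GBmem_iff hg, mem_xL hg]
  simp only [xL, extL, List.length_append, List.length_singleton, Nat.add_right_cancel_iff]
  tauto

theorem gb_xR (hg : Gtl Q R (cpl Q R)) {m : ℕ} {x : PathDat Q × PathDat Q} {a : Q.A}
    (h : GBmem Q R m x) (ha : Q.tgt a = x.1.1) :
    GBmem Q R (m + 1) (xR Q a x) ↔ Rc Q R (cpl Q R) a x := by
  rw [GBmem_iff hg] at *
  rw [mem_xR hg _ _ ha h.1.2.2.1]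
  simp only [xR, extR, List.length_cons, Nat.add_right_cancel_iff]
  tauto

theorem dL_eq (hg : Gtl Q R (cpl Q R)) {m : ℕ} {x : PathDat Q × PathDat Q} {b : Q.A}
    (ht : ¬ Triv x) (hb : Lc Q R (cpl Q R) b x) :
    dL k R m x = bv k Q R (m + 1) (xL Q b x) := by
  unfold dL
  rw [Finset.sum_eq_single b]
  · intro b' _ hne
    apply bv_not
    rw [gb_xL hg]
    rintro ⟨_, h⟩
    exact hne (Lc_unique hg ht h hb)
  · simp

theorem dL_zero (hg : Gtl Q R (cpl Q R)) {m : ℕ} {x : PathDat Q × PathDat Q}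
    (hb : ∀ b, ¬ Lc Q R (cpl Q R) b x) : dL k R m x = 0 := by
  unfold dL
  apply Finset.sum_eq_zero
  intro b _
  apply bv_not
  rw [gb_xL hg]
  exact fun h => hb b h.2

theorem dR_eq (hg : Gtl Q R (cpl Q R)) {m : ℕ} {x : PathDat Q × PathDat Q} {a : Q.A}
    (h : GBmem Q R m x) (ht : ¬ Triv x) (ha : Rc Q R (cpl Q R) a x) :
    dR k R m x = bv k Q R (m + 1) (xR Q a x) := by
  unfold dR
  rw [Finset.sum_eq_single a]
  · rw [if_pos ha.1]
  · intro b' _ hne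
    split_ifs with h1
    · apply bv_not
      rw [gb_xR hg h h1]
      intro h
      exact hne (Rc_unique hg ht h ha)
    · rfl
  · simp

theorem dR_zero (hg : Gtl Q R (cpl Q R)) {m : ℕ} {x : PathDat Q × PathDat Q}
    (h : GBmem Q R m x) (ha : ∀ a, ¬ Rc Q R (cpl Q R) a x) : dR k R m x = 0 := by
  unfold dR
  apply Finset.sum_eq_zero
  intro b _
  split_ifs with h1
  · apply bv_not
    rw [gb_xR hg h h1]
    exact ha b
  · rfl

/-! Representatives of cycles -/

open Classical in
noncomputable def rp (Sb : Set (PathDat Q)) (p : PathDat Q) : PathDat Q × ℕ :=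
  if h : ∃ q : PathDat Q × ℕ, q.1 ∈ Sb ∧ q.2 < periodP Q q.1 ∧ rotI Q q.2 q.1 = p then h.choose
  else (p, 0)

theorem cmp_periodic {S : Set (Q.A × Q.A)} (hc : ∀ {a b}, (a, b) ∈ S → Q.tgt a = Q.src b)
    (hf : ∀ {a b b'}, (a, b) ∈ S → (a, b') ∈ S → b = b') {p : PathDat Q} (h : Cmp Q S p) :
    p ∈ Function.periodicPts (rotP Q) :=
  Function.mk_mem_periodicPts (List.length_pos_iff.2 (cmp_ne h)) (rotI_len h hc hf)

theorem rp_spec {S : Set (Q.A × Q.A)} (hc : ∀ {a b}, (a, b) ∈ S → Q.tgt a = Q.src b)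
    (hf : ∀ {a b b'}, (a, b) ∈ S → (a, b') ∈ S → b = b') {Sb : Set (PathDat Q)}
    (hS : RepSys Q S Sb) {p : PathDat Q} (h : Cmp Q S p) :
    (rp Sb p).1 ∈ Sb ∧ (rp Sb p).2 < periodP Q (rp Sb p).1 ∧
      rotI Q (rp Sb p).2 (rp Sb p).1 = p := by
  have hex : ∃ q : PathDat Q × ℕ, q.1 ∈ Sb ∧ q.2 < periodP Q q.1 ∧ rotI Q q.2 q.1 = p := by
    obtain ⟨p0, hp0, i, hi⟩ := hS.ex p h
    have hper := cmp_periodic hc hf (hS.cmp _ hp0)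
    refine ⟨(p0, i % periodP Q p0), hp0, ?_, ?_⟩
    · rw [periodP_eq _ hper]
      exact Nat.mod_lt _ (Function.minimalPeriod_pos_of_mem_periodicPts hper)
    · rw [← hi, periodP_eq _ hper]
      exact Function.iterate_mod_minimalPeriod_eq
  unfold rp
  rw [dif_pos hex]
  exact hex.choose_spec

theorem rp_eq {S : Set (Q.A × Q.A)} (hc : ∀ {a b}, (a, b) ∈ S → Q.tgt a = Q.src b)
    (hf : ∀ {a b b'}, (a, b) ∈ S → (a, b') ∈ S → b = b') {Sb : Set (PathDat Q)}
    (hS : RepSys Q S Sb) {q : PathDat Q} (hq : q ∈ Sb) {i : ℕ} (hi : i < periodP Q q) :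
    rp Sb (rotI Q i q) = (q, i) := by
  have hcq := hS.cmp _ hq
  obtain ⟨h1, h2, h3⟩ := rp_spec hc hf hS (rotI_cmp hcq hc hf i).1
  obtain ⟨j, hj⟩ := rotI_symm hc hf hcq (i := i) rfl
  have hper := cmp_periodic hc hf hcq
  generalize hr : rp Sb (rotI Q i q) = r at h1 h2 h3
  obtain ⟨p0, i0⟩ := r
  simp only at *
  have e : p0 = q := by
    apply hS.uniq _ h1 _ hq (j + i0)
    rw [← hj, ← h3]
    simp only [rotI]
    rw [Function.iterate_add_apply]
  subst e
  rw [periodP_eq _ hper] at hi h2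
  have := (Function.iterate_eq_iterate_iff_of_lt_minimalPeriod h2 hi).1 h3
  rw [this]

variable (k R) in
noncomputable def cycH {M : Type} [AddCommGroup M] (Sb : Set (PathDat Q)) (u : PathDat Q → M)
    (p : PathDat Q) : M :=
  - ∑ j ∈ Finset.range (rp Sb p).2, u (rotI Q j (rp Sb p).1)

/-- The generic computation for cycles. -/
theorem cycH_y {M N : Type} [AddCommGroup M] [AddCommGroup N] [Module k M] [Module k N]
    {S : Set (Q.A × Q.A)} (hc : ∀ {a b}, (a, b) ∈ S → Q.tgt a = Q.src b)
    (hf : ∀ {a b b'}, (a, b) ∈ S → (a, b') ∈ S → b = b') {Sb : Set (PathDat Q)}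
    (hS : RepSys Q S Sb) (d : M →ₗ[k] N) (u : PathDat Q → M) (y : PathDat Q → N)
    {p : PathDat Q} (h : Cmp Q S p)
    (hd : ∀ i, d (u (rotI Q i (rp Sb p).1)) =
      y (rotI Q i (rp Sb p).1) - y (rotI Q (i + 1) (rp Sb p).1)) :
    y p - d (cycH Sb u p) = y (rp Sb p).1 := by
  obtain ⟨h1, h2, h3⟩ := rp_spec hc hf hS h
  unfold cycH
  rw [map_neg, map_sum, Finset.sum_congr rfl (fun i _ => hd i), Finset.sum_range_sub', h3]
  simp [rotI]

theorem cycH_u {M N : Type} [AddCommGroup M] [AddCommGroup N] [Module k M] [Module k N]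
    {S : Set (Q.A × Q.A)} (hc : ∀ {a b}, (a, b) ∈ S → Q.tgt a = Q.src b)
    (hf : ∀ {a b b'}, (a, b) ∈ S → (a, b') ∈ S → b = b') {Sb : Set (PathDat Q)}
    (hS : RepSys Q S Sb) (H : N →ₗ[k] M) (u : PathDat Q → M) (y : PathDat Q → N)
    {p : PathDat Q} (h : Cmp Q S p)
    (hH : ∀ i, H (y (rotI Q i p)) = cycH Sb u (rotI Q i p)) :
    u p - H (y p - y (rotI Q 1 p)) = 0 ∨
    u p - H (y p - y (rotI Q 1 p)) =
      ∑ j ∈ Finset.range (periodP Q (rp Sb p).1), u (rotI Q j (rp Sb p).1) := by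
  obtain ⟨h1, h2, h3⟩ := rp_spec hc hf hS h
  have hper := cmp_periodic hc hf (hS.cmp _ h1)
  have e0 := hH 0
  have e1 := hH 1
  have e00 : rotI Q 0 p = p := rfl
  rw [e00] at e0
  rw [map_sub, e0, e1]
  generalize hr : rp Sb p = r at *
  obtain ⟨q, i⟩ := r
  simp only at *
  have e2 : rotI Q 1 p = rotI Q (i + 1) q := by
    rw [← h3]; simp only [rotI]
    rw [← Function.iterate_add_apply, Nat.add_comm]
  by_cases hi : i + 1 < periodP Q q
  · left
    unfold cycH
    rw [hr, e2, rp_eq hc hf hS h1 hi]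
    simp only
    rw [Finset.sum_range_succ, h3]
    abel
  · right
    have hi' : i + 1 = periodP Q q := by omega
    have e3 : rotI Q (i + 1) q = rotI Q 0 q := by
      rw [hi', periodP_eq _ hper]
      exact Function.iterate_minimalPeriod
    unfold cycH
    rw [hr, e2, e3, rp_eq hc hf hS h1 (by omega)]
    simp only
    rw [← hi', Finset.sum_range_succ, h3]
    simp [add_comm]

/-! The homotopy -/

open Classical in
variable (k R) in
noncomputable def hB (Sb Sg : Set (PathDat Q)) (τ : Q.A → Q.V → k) (m : ℕ)
    (w : PathDat Q × PathDat Q) : Coch k Q R m :=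
  if lEq w then
    if w.1.2.length = 1 ∧ w.2.2.length = 1 then
      w.1.2.head?.elim 0 (fun a => ∑ v, τ a v • bv k Q R m ((v, []), (v, [])))
    else if hEq w ∧ w.1.2.length = 1 then
      cycH Sb (fun p => bv k Q R m ((p.1, []), p)) (ini w).2
    else if hEq w ∧ w.2.2.length = 1 then
      if (-1 : k) ^ m = 1 then cycH Sg (fun p => bv k Q R m (p, (p.1, []))) (ini w).1
      else (2⁻¹ : k) • ∑ j ∈ Finset.range m, (-1 : k) ^ j •
        bv k Q R m (rotI Q j (ini w).1, ((rotI Q j (ini w).1).1, []))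
    else bv k Q R m (ini w)
  else if hEq w ∧ ¬ ∃ b, Lc Q R (cpl Q R) b w then -((-1 : k) ^ m • bv k Q R m (tl w))
  else 0

variable (k R) in
noncomputable def hM (Sb Sg : Set (PathDat Q)) (τ : Q.A → Q.V → k) (m : ℕ) :
    Coch k Q R (m + 1) →ₗ[k] Coch k Q R m :=
  Finsupp.linearCombination k (fun w => hB k R Sb Sg τ m w.val)

variable {Sb Sg : Set (PathDat Q)} {τ : Q.A → Q.V → k}

theorem hM_bv {m : ℕ} {w : PathDat Q × PathDat Q} (h : GBmem Q R (m + 1) w) :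
    hM k R Sb Sg τ m (bv k Q R (m + 1) w) = hB k R Sb Sg τ m w := by
  rw [bv_of h, hM, Finsupp.linearCombination_single, one_smul]

theorem hB_FF {m : ℕ} {w : PathDat Q × PathDat Q} (h1 : ¬ lEq w) (h2 : ¬ hEq w) :
    hB k R Sb Sg τ m w = 0 := by
  unfold hB
  rw [if_neg h1, if_neg (fun h => h2 h.1)]

theorem hB_L (hg : Gtl Q R (cpl Q R)) {m : ℕ} {x : PathDat Q × PathDat Q} {b : Q.A}
    (h : Core Q R (cpl Q R) x) (hb : Lc Q R (cpl Q R) b x) :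
    hB k R Sb Sg τ m (xL Q b x) = bv k Q R m x := by
  have h1 := core_L_hEq hg h hb
  unfold hB
  rw [if_pos (lEq_xL _ _), if_neg, if_neg (fun h => h1 h.1), if_neg (fun h => h1 h.1), ini_xL]
  rintro ⟨e1, e2⟩
  simp [xL, extL] at e1 e2
  exact h.not_triv ⟨e1, e2⟩

theorem hB_LR {m : ℕ} {x : PathDat Q × PathDat Q} {a b : Q.A} :
    hB k R Sb Sg τ m (xL Q b (xR Q a x)) = bv k Q R m (xR Q a x) := by
  unfold hB
  rw [if_pos (lEq_xL _ _), if_neg, if_neg, if_neg, ini_xL] <;>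
  simp [xL, extL, xR, extR]

theorem hB_R (hg : Gtl Q R (cpl Q R)) {m : ℕ} {x : PathDat Q × PathDat Q} {a : Q.A}
    (h : Core Q R (cpl Q R) x) (ha : Rc Q R (cpl Q R) a x) (hb : ∀ b, ¬ Lc Q R (cpl Q R) b x) :
    hB k R Sb Sg τ m (xR Q a x) = -((-1 : k) ^ m • bv k Q R m x) := by
  unfold hB
  rw [if_neg (core_R_lEq hg h ha), if_pos, tl_xR _ _ ha.1 h.1.2.2.1]
  refine ⟨hEq_xR _ _, ?_⟩
  rintro ⟨b, hb'⟩
  exact hb b (Lc_of_xR ha.1 hb')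

theorem hB_R0 (hg : Gtl Q R (cpl Q R)) {m : ℕ} {x : PathDat Q × PathDat Q} {a b : Q.A}
    (h : Core Q R (cpl Q R) x) (ha : Rc Q R (cpl Q R) a x) (hb : Lc Q R (cpl Q R) b x) :
    hB k R Sb Sg τ m (xR Q a x) = 0 := by
  unfold hB
  rw [if_neg (core_R_lEq hg h ha), if_neg]
  rintro ⟨_, h2⟩
  exact h2 ⟨b, core_LR hg h hb ha⟩

theorem hB_arr {m : ℕ} (a : Q.A) :
    hB k R Sb Sg τ m ((Q.src a, [a]), (Q.src a, [a])) =
      ∑ v, τ a v • bv k Q R m ((v, []), (v, [])) := by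
  unfold hB
  rw [if_pos (by simp [lEq]), if_pos (by simp)]
  simp

theorem hB_E {m : ℕ} {p : PathDat Q} {c : Q.A} (hc : p.2.head? = some c) :
    hB k R Sb Sg τ m (xL Q c ((p.1, []), p)) =
      cycH Sb (fun p => bv k Q R m ((p.1, []), p)) p := by
  have hne : p.2 ≠ [] := by intro e; simp [e] at hc
  unfold hB
  rw [if_pos (lEq_xL _ _), if_neg, if_pos, ini_xL]
  · simp [hEq, xL, extL, hc]
  · simpa [xL, extL] using hne

open Classical in
theorem hB_F {m : ℕ} {p : PathDat Q} {c : Q.A} (hc : p.2.head? = some c) :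
    hB k R Sb Sg τ m (xL Q c (p, (p.1, []))) =
      if (-1 : k) ^ m = 1 then cycH Sg (fun p => bv k Q R m (p, (p.1, []))) p
      else (2⁻¹ : k) • ∑ j ∈ Finset.range m, (-1 : k) ^ j •
        bv k Q R m (rotI Q j p, ((rotI Q j p).1, [])) := by
  have hne : p.2 ≠ [] := by intro e; simp [e] at hc
  unfold hB
  rw [if_pos (lEq_xL _ _), if_neg, if_neg, if_pos, ini_xL]
  · simp [hEq, xL, extL, hc]
  · simp [xL, extL, hne]
  · simp [xL, extL, hne]

end
end GentleTT

namespace GentleTT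

/-! ### The differential on the classes of basis elements -/

section
variable {k : Type} [Field k] {Q : Quiv} {R : Set (Q.A × Q.A)}

theorem d_both (hg : Gtl Q R (cpl Q R)) {m : ℕ} {x : PathDat Q × PathDat Q}
    (h : GBmem Q R m x) (ht : ¬ Triv x) (h1 : hEq x) (h2 : lEq x) :
    dLin k Q R m (bv k Q R m x) = 0 := by
  rw [d_bv h, dL_zero hg (fun b hb => no_Lc hg ht h2 hb),
    dR_zero hg h (fun b hb => no_Rc hg ht h1 hb)]
  simp

theorem gb_L (hg : Gtl Q R (cpl Q R)) {m : ℕ} {x : PathDat Q × PathDat Q} {b : Q.A}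
    (h : GBmem Q R m x) (hb : Lc Q R (cpl Q R) b x) : GBmem Q R (m + 1) (xL Q b x) :=
  (gb_xL hg).2 ⟨h, hb⟩

theorem gb_R (hg : Gtl Q R (cpl Q R)) {m : ℕ} {x : PathDat Q × PathDat Q} {a : Q.A}
    (h : GBmem Q R m x) (ha : Rc Q R (cpl Q R) a x) : GBmem Q R (m + 1) (xR Q a x) :=
  (gb_xR hg h ha.1).2 ha

theorem d_L_R (hg : Gtl Q R (cpl Q R)) {m : ℕ} {x : PathDat Q × PathDat Q} {a b : Q.A}
    (h : GBmem Q R m x) (hx : Core Q R (cpl Q R) x) (hb : Lc Q R (cpl Q R) b x)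
    (ha : Rc Q R (cpl Q R) a x) :
    dLin k Q R (m + 1) (bv k Q R (m + 1) (xL Q b x)) =
      (-1 : k) ^ m • bv k Q R (m + 2) (xL Q b (xR Q a x)) := by
  rw [d_bv (gb_L hg h hb), dL_zero hg (fun c hc => no_Lc hg (not_triv_xL _ _) (lEq_xL _ _) hc),
    dR_eq hg (gb_L hg h hb) (not_triv_xL _ _) (core_RL hg hx hb ha), xL_xR]
  rw [pow_succ]; simp

theorem d_L_nR (hg : Gtl Q R (cpl Q R)) {m : ℕ} {x : PathDat Q × PathDat Q} {b : Q.A}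
    (h : GBmem Q R m x) (hb : Lc Q R (cpl Q R) b x)
    (ha : ∀ a, ¬ Rc Q R (cpl Q R) a x) :
    dLin k Q R (m + 1) (bv k Q R (m + 1) (xL Q b x)) = 0 := by
  rw [d_bv (gb_L hg h hb), dL_zero hg (fun c hc => no_Lc hg (not_triv_xL _ _) (lEq_xL _ _) hc),
    dR_zero hg (gb_L hg h hb) (fun a h' => ha a (Rc_of_xL h'))]
  simp

theorem d_R_L (hg : Gtl Q R (cpl Q R)) {m : ℕ} {x : PathDat Q × PathDat Q} {a b : Q.A}
    (h : GBmem Q R m x) (hx : Core Q R (cpl Q R) x) (hb : Lc Q R (cpl Q R) b x)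
    (ha : Rc Q R (cpl Q R) a x) :
    dLin k Q R (m + 1) (bv k Q R (m + 1) (xR Q a x)) =
      bv k Q R (m + 2) (xL Q b (xR Q a x)) := by
  rw [d_bv (gb_R hg h ha), dR_zero hg (gb_R hg h ha)
    (fun c hc => no_Rc hg (not_triv_xR _ _) (hEq_xR _ _) hc),
    dL_eq hg (not_triv_xR _ _) (core_LR hg hx hb ha)]
  simp

theorem d_R_nL (hg : Gtl Q R (cpl Q R)) {m : ℕ} {x : PathDat Q × PathDat Q} {a : Q.A}
    (h : GBmem Q R m x) (hb : ∀ b, ¬ Lc Q R (cpl Q R) b x)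
    (ha : Rc Q R (cpl Q R) a x) :
    dLin k Q R (m + 1) (bv k Q R (m + 1) (xR Q a x)) = 0 := by
  rw [d_bv (gb_R hg h ha), dR_zero hg (gb_R hg h ha)
    (fun c hc => no_Rc hg (not_triv_xR _ _) (hEq_xR _ _) hc),
    dL_zero hg (fun c hc => hb c (Lc_of_xR ha.1 hc))]
  simp

theorem gb_LR (hg : Gtl Q R (cpl Q R)) {m : ℕ} {x : PathDat Q × PathDat Q} {a b : Q.A}
    (h : GBmem Q R m x) (hx : Core Q R (cpl Q R) x) (hb : Lc Q R (cpl Q R) b x)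
    (ha : Rc Q R (cpl Q R) a x) : GBmem Q R (m + 2) (xL Q b (xR Q a x)) :=
  gb_L hg (gb_R hg h ha) (core_LR hg hx hb ha)

theorem d_LR (hg : Gtl Q R (cpl Q R)) {m : ℕ} {x : PathDat Q × PathDat Q} {a b : Q.A}
    (h : GBmem Q R m x) (hx : Core Q R (cpl Q R) x) (hb : Lc Q R (cpl Q R) b x)
    (ha : Rc Q R (cpl Q R) a x) :
    dLin k Q R (m + 2) (bv k Q R (m + 2) (xL Q b (xR Q a x))) = 0 := by
  apply d_both hg (gb_LR hg h hx hb ha) (not_triv_xL _ _) _ (lEq_xL _ _)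
  rw [xL_xR]; exact hEq_xR _ _

/-! Cycles -/

variable (k R) in
noncomputable def uB (m : ℕ) (p : PathDat Q) : Coch k Q R m := bv k Q R m ((p.1, []), p)

variable (k R) in
noncomputable def uG (m : ℕ) (p : PathDat Q) : Coch k Q R m := bv k Q R m (p, (p.1, []))

variable (k R) in
noncomputable def yB (m : ℕ) (p : PathDat Q) : Coch k Q R m :=
  p.2.head?.elim 0 (fun c => bv k Q R m (xL Q c ((p.1, []), p)))

variable (k R) in
noncomputable def yG (m : ℕ) (p : PathDat Q) : Coch k Q R m :=
  p.2.head?.elim 0 (fun c => bv k Q R m (xL Q c (p, (p.1, []))))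

theorem yB_eq {m : ℕ} {p : PathDat Q} {c : Q.A} (hc : p.2.head? = some c) :
    yB k R m p = bv k Q R m (xL Q c ((p.1, []), p)) := by simp [yB, hc]

theorem yG_eq {m : ℕ} {p : PathDat Q} {c : Q.A} (hc : p.2.head? = some c) :
    yG k R m p = bv k Q R m (xL Q c (p, (p.1, []))) := by simp [yG, hc]

theorem rotP_form {p : PathDat Q} {d : Q.A} (hd : p.2.getLast? = some d) :
    rotP Q p = (Q.src d, d :: p.2.dropLast) := by
  unfold rotP; rw [hd]

theorem drop_form {p : PathDat Q} {d : Q.A} (hd : p.2.getLast? = some d) :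
    p.2.dropLast ++ [d] = p.2 := by
  obtain ⟨v, l⟩ := p
  rcases List.eq_nil_or_concat l with rfl | ⟨l', c, rfl⟩
  · simp at hd
  · simpa using hd.symm

theorem yB_rot {m : ℕ} {p : PathDat Q} {d : Q.A} (hd : p.2.getLast? = some d) :
    yB k R m (rotP Q p) = bv k Q R m (xR Q d ((p.1, []), p)) := by
  rw [rotP_form hd, yB_eq (c := d) (by simp)]
  simp [xL, xR, extL, extR, drop_form hd]

theorem yG_rot {m : ℕ} {p : PathDat Q} {d : Q.A} (hd : p.2.getLast? = some d) :
    yG k R m (rotP Q p) = bv k Q R m (xR Q d (p, (p.1, []))) := by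
  rw [rotP_form hd, yG_eq (c := d) (by simp)]
  simp [xL, xR, extL, extR, drop_form hd]

theorem gb_uB (hg : Gtl Q R (cpl Q R)) {p : PathDat Q} (h : Cmp Q (cpl Q R) p) :
    GBmem Q R 0 ((p.1, []), p) := (GBmem_iff hg _ _).2 ⟨mem_cyc h, rfl⟩

theorem gb_uG (hg : Gtl Q R (cpl Q R)) {p : PathDat Q} (h : Cmp Q R p) :
    GBmem Q R p.2.length (p, (p.1, [])) := (GBmem_iff hg _ _).2 ⟨(mem_cyc h).swap, rfl⟩

theorem cycG_Lc (hg : Gtl Q R (cpl Q R)) {p : PathDat Q} (h : Cmp Q R p) :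
    ∃ c d, p.2.head? = some c ∧ p.2.getLast? = some d ∧
      Lc Q R (cpl Q R) c (p, (p.1, [])) ∧ Rc Q R (cpl Q R) d (p, (p.1, [])) := by
  have hm : Mem Q (cpl Q R) R ((p.1, []), p) := mem_cyc h
  obtain ⟨c, d, h1, h2, _, h3, h4⟩ := cyc_Lc hg.swap hm rfl h
  exact ⟨c, d, h1, h2, h3.swap hm, h4.swap hm⟩

theorem cycB_Lc (hg : Gtl Q R (cpl Q R)) {p : PathDat Q} (h : Cmp Q (cpl Q R) p) :
    ∃ c d, p.2.head? = some c ∧ p.2.getLast? = some d ∧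
      Lc Q R (cpl Q R) c ((p.1, []), p) ∧ Rc Q R (cpl Q R) d ((p.1, []), p) := by
  obtain ⟨c, d, h1, h2, _, h3, h4⟩ := cyc_Lc hg (mem_cyc h) rfl h
  exact ⟨c, d, h1, h2, h3, h4⟩

theorem d_uB (hg : Gtl Q R (cpl Q R)) {p : PathDat Q} (h : Cmp Q (cpl Q R) p) :
    dLin k Q R 0 (uB k R 0 p) = yB k R 1 p - yB k R 1 (rotP Q p) := by
  obtain ⟨c, d, h1, h2, h3, h4⟩ := cycB_Lc hg h
  have ht : ¬ Triv ((p.1, []), p) := fun e => cmp_ne h e.2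
  rw [uB, d_bv (gb_uB hg h), dL_eq hg ht h3, dR_eq hg (gb_uB hg h) ht h4, yB_eq h1, yB_rot h2]
  simp

theorem d_uG (hg : Gtl Q R (cpl Q R)) {p : PathDat Q} (h : Cmp Q R p) {m : ℕ}
    (hm : p.2.length = m) :
    dLin k Q R m (uG k R m p) = yG k R (m + 1) p - (-1 : k) ^ m • yG k R (m + 1) (rotP Q p) := by
  obtain ⟨c, d, h1, h2, h3, h4⟩ := cycG_Lc hg h
  have ht : ¬ Triv (p, (p.1, [])) := fun e => cmp_ne h e.1
  subst hm
  rw [uG, d_bv (gb_uG hg h), dL_eq hg ht h3, dR_eq hg (gb_uG hg h) ht h4, yG_eq h1, yG_rot h2]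

theorem gb_yB (hg : Gtl Q R (cpl Q R)) {p : PathDat Q} (h : Cmp Q (cpl Q R) p) {c : Q.A}
    (hc : p.2.head? = some c) : GBmem Q R 1 (xL Q c ((p.1, []), p)) := by
  obtain ⟨c', d, h1, h2, h3, h4⟩ := cycB_Lc hg h
  obtain rfl : c' = c := by simpa [hc] using h1.symm
  exact gb_L hg (gb_uB hg h) h3

theorem gb_yG (hg : Gtl Q R (cpl Q R)) {p : PathDat Q} (h : Cmp Q R p) {c : Q.A}
    (hc : p.2.head? = some c) : GBmem Q R (p.2.length + 1) (xL Q c (p, (p.1, []))) := by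
  obtain ⟨c', d, h1, h2, h3, h4⟩ := cycG_Lc hg h
  obtain rfl : c' = c := by simpa [hc] using h1.symm
  exact gb_L hg (gb_uG hg h) h3

theorem d_yB (hg : Gtl Q R (cpl Q R)) {p : PathDat Q} (h : Cmp Q (cpl Q R) p) :
    dLin k Q R 1 (yB k R 1 p) = 0 := by
  obtain ⟨c, d, h1, h2, h3, h4⟩ := cycB_Lc hg h
  rw [yB_eq h1]
  apply d_both hg (gb_yB hg h h1) (not_triv_xL _ _) _ (lEq_xL _ _)
  simp [hEq, xL, extL, h1]

theorem d_yG (hg : Gtl Q R (cpl Q R)) {p : PathDat Q} (h : Cmp Q R p) {m : ℕ}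
    (hm : p.2.length = m) :
    dLin k Q R (m + 1) (yG k R (m + 1) p) = 0 := by
  obtain ⟨c, d, h1, h2, h3, h4⟩ := cycG_Lc hg h
  subst hm
  rw [yG_eq h1]
  apply d_both hg (gb_yG hg h h1) (not_triv_xL _ _) _ (lEq_xL _ _)
  simp [hEq, xL, extL, h1]

/-! Vertices and arrows -/

variable (k R) in
noncomputable def ee (v : Q.V) : Coch k Q R 0 := bv k Q R 0 ((v, []), (v, []))

variable (k R) in
noncomputable def ea (a : Q.A) : Coch k Q R 1 := bv k Q R 1 ((Q.src a, [a]), (Q.src a, [a]))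

theorem gb_ee (hg : Gtl Q R (cpl Q R)) (v : Q.V) : GBmem Q R 0 ((v, []), (v, [])) :=
  (GBmem_iff hg _ _).2 ⟨⟨⟨by simp, by simp⟩, ⟨by simp, by simp⟩, rfl, rfl⟩, rfl⟩

theorem gb_ea (hg : Gtl Q R (cpl Q R)) (a : Q.A) :
    GBmem Q R 1 ((Q.src a, [a]), (Q.src a, [a])) :=
  (GBmem_iff hg _ _).2 ⟨⟨⟨by simp, by simp⟩, ⟨by simp, by simp⟩, rfl, rfl⟩, rfl⟩

theorem d_ea (hg : Gtl Q R (cpl Q R)) (a : Q.A) : dLin k Q R 1 (ea k R a) = 0 := by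
  apply d_both hg (gb_ea hg a) (by simp [Triv]) (by simp [hEq]) (by simp [lEq])

theorem d_ee (hg : Gtl Q R (cpl Q R)) (v : Q.V) : dLin k Q R 0 (ee k R v) =
    ∑ a, ((if Q.src a = v then (1 : k) else 0) - (if Q.tgt a = v then 1 else 0)) • ea k R a := by
  rw [ee, d_bv (gb_ee hg v)]
  unfold dL dR
  rw [pow_zero, one_smul, ← Finset.sum_sub_distrib]
  apply Finset.sum_congr rfl
  intro a _
  rw [sub_smul]
  congr 1
  · split_ifs with h
    · subst h; simp [ea, xL, extL]
    · rw [zero_smul]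
      apply bv_not
      rw [gb_xL hg]
      rintro ⟨_, h1, _⟩
      exact h h1
  · split_ifs with h
    · simp [ea, xR, extR]
    · simp

/-- The square of the differential vanishes. -/
theorem dd_bv (hg : Gtl Q R (cpl Q R)) {n : ℕ} {w : PathDat Q × PathDat Q}
    (h : GBmem Q R n w) : dLin k Q R (n + 1) (dLin k Q R n (bv k Q R n w)) = 0 := by
  obtain ⟨hm, hn⟩ := (GBmem_iff hg _ _).1 h
  have hcl := classify hg hm
  cases hcl with
  | vtx v =>
    subst hn
    change dLin k Q R 1 (dLin k Q R 0 (ee k R v)) = 0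
    rw [d_ee hg, map_sum]
    apply Finset.sum_eq_zero
    intro a _
    rw [map_smul, d_ea hg, smul_zero]
  | arr a => rw [d_both hg h (by simp [Triv]) (by simp [hEq]) (by simp [lEq]), map_zero]
  | cycB p hp =>
    subst hn
    change dLin k Q R 1 (dLin k Q R 0 (uB k R 0 p)) = 0
    rw [d_uB hg hp, map_sub, d_yB hg hp, d_yB hg (p := rotP Q p) (rotI_cmp hp hg.comp' hg.fwd' 1).1, sub_zero]
  | cycG p hp =>
    change dLin k Q R (n + 1) (dLin k Q R n (uG k R n p)) = 0
    have h1 := rotI_cmp hp hg.comp hg.fwd 1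
    rw [d_uG hg hp hn, map_sub, d_yG hg hp hn, map_smul, d_yG hg (p := rotP Q p) h1.1 (h1.2.trans hn)]
    simp
  | core _ hx =>
    rw [d_bv h]
    by_cases hb : ∃ b, Lc Q R (cpl Q R) b w <;> by_cases ha : ∃ a, Rc Q R (cpl Q R) a w
    · obtain ⟨b, hb⟩ := hb
      obtain ⟨a, ha⟩ := ha
      rw [dL_eq hg hx.not_triv hb, dR_eq hg h hx.not_triv ha, map_sub, map_smul,
        d_L_R hg h hx hb ha, d_R_L hg h hx hb ha, sub_self]
    · obtain ⟨b, hb⟩ := hb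
      push Not at ha
      rw [dL_eq hg hx.not_triv hb, dR_zero hg h ha, map_sub, map_smul, d_L_nR hg h hb ha]
      simp
    · obtain ⟨a, ha⟩ := ha
      push Not at hb
      rw [dL_zero hg hb, dR_eq hg h hx.not_triv ha, map_sub, map_smul, d_R_nL hg h hb ha]
      simp
    · push Not at ha hb
      rw [dL_zero hg hb, dR_zero hg h ha]
      simp
  | coreL x hx b hb =>
    obtain ⟨n, rfl⟩ : ∃ j, n = j + 1 := ⟨x.1.2.length, by rw [← hn]; simp [xL, extL]⟩
    have hx' := ((gb_xL hg).1 h).1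
    by_cases ha : ∃ a, Rc Q R (cpl Q R) a x
    · obtain ⟨a, ha⟩ := ha
      rw [d_L_R hg hx' hx hb ha, map_smul, d_LR hg hx' hx hb ha, smul_zero]
    · push Not at ha
      rw [d_L_nR hg hx' hb ha, map_zero]
  | coreR x hx a ha =>
    have hx' : GBmem Q R x.1.2.length x := (GBmem_iff hg _ _).2 ⟨hx.1, rfl⟩
    obtain rfl : n = x.1.2.length + 1 := by rw [← hn]; simp [xR, extR]
    by_cases hb : ∃ b, Lc Q R (cpl Q R) b x
    · obtain ⟨b, hb⟩ := hb
      rw [d_R_L hg hx' hx hb ha, d_LR hg hx' hx hb ha]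
    · push Not at hb
      rw [d_R_nL hg hx' hb ha, map_zero]
  | coreLR x hx a b hb ha =>
    have hx' : GBmem Q R x.1.2.length x := (GBmem_iff hg _ _).2 ⟨hx.1, rfl⟩
    obtain rfl : n = x.1.2.length + 2 := by rw [← hn]; simp [xR, extR, xL, extL]
    rw [d_LR hg hx' hx hb ha, map_zero]
  | cycB' p hp c hc =>
    obtain rfl : n = 1 := by rw [← hn]; simp [xL, extL]
    rw [← yB_eq hc, d_yB hg hp, map_zero]
  | cycG' p hp c hc =>
    obtain rfl : n = p.2.length + 1 := by rw [← hn]; simp [xL, extL]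
    rw [← yG_eq hc, d_yG hg hp rfl, map_zero]

theorem coch_ext {m : ℕ} {N : Type} [AddCommGroup N] [Module k N]
    {f g : Coch k Q R m →ₗ[k] N}
    (h : ∀ w, GBmem Q R m w → f (bv k Q R m w) = g (bv k Q R m w)) : f = g := by
  apply Finsupp.lhom_ext'
  intro w
  apply LinearMap.ext_ring
  have := h w.1 w.2
  rw [bv_of w.2] at this
  exact this

theorem dd (hg : Gtl Q R (cpl Q R)) {n : ℕ} (z : Coch k Q R n) :
    dLin k Q R (n + 1) (dLin k Q R n z) = 0 := by
  have : dLin k Q R (n + 1) ∘ₗ dLin k Q R n = 0 :=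
    coch_ext (fun w hw => by simpa using dd_bv hg hw)
  exact LinearMap.congr_fun this z

theorem coch_mem {m : ℕ} {N : Type} [AddCommGroup N] [Module k N] {f : Coch k Q R m →ₗ[k] N}
    {P : Submodule k N} (h : ∀ w, GBmem Q R m w → f (bv k Q R m w) ∈ P) (z : Coch k Q R m) :
    f z ∈ P := by
  induction z using Finsupp.induction_linear with
  | zero => simp
  | add a b ha hb => rw [map_add]; exact P.add_mem ha hb
  | single w c =>
    have h1 := h w.1 w.2
    rw [bv_of w.2] at h1
    have : Finsupp.single w c = c • Finsupp.single w (1 : k) := by simp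
    rw [this, map_smul]
    exact P.smul_mem _ h1

end
end GentleTT

namespace GentleTT

/-! ### The spanning tree -/

section
variable {k : Type} [Field k] {Q : Quiv} {R : Set (Q.A × Q.A)} {T : Set Q.A}

theorem tree_const (hT : IsSpanningTree Q T) {M : Type} (g : Q.V → M)
    (h : ∀ c ∈ T, g (Q.src c) = g (Q.tgt c)) (v w : Q.V) : g v = g w := by
  have := hT.1 v w
  induction this with
  | refl => rfl
  | tail _ h2 ih =>
    obtain ⟨a, ha, (⟨h1, h2⟩ | ⟨h1, h2⟩)⟩ := h2
    · rw [ih, ← h1, ← h2, h a ha]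
    · rw [ih, ← h1, ← h2, h a ha]

variable (k) in
theorem tree_tau (hT : IsSpanningTree Q T) :
    ∃ τ : Q.A → Q.V → k, (∀ a, a ∉ T → τ a = 0) ∧
      ∀ a, ∀ c ∈ T, τ a (Q.src c) - τ a (Q.tgt c) = if a = c then 1 else 0 := by
  classical
  let D : (Q.V → k) →ₗ[k] (T → k) :=
    { toFun := fun g c => g (Q.src c) - g (Q.tgt c)
      map_add' := by intros; ext; simp; ring
      map_smul' := by intros; ext; simp; ring }
  have hker : LinearMap.ker D ≤ Submodule.span k {fun _ => (1 : k)} := by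
    intro g hg
    rw [Submodule.mem_span_singleton]
    by_cases hV : Nonempty Q.V
    · obtain ⟨v0⟩ := hV
      refine ⟨g v0, ?_⟩
      funext v
      have := tree_const hT g (fun c hc => by
        have := congrFun (LinearMap.mem_ker.1 hg) ⟨c, hc⟩
        exact sub_eq_zero.1 this) v0 v
      simp [this]
    · refine ⟨0, ?_⟩
      funext v
      exact absurd ⟨v⟩ hV
  have h1 : Module.finrank k (LinearMap.ker D) ≤ 1 :=
    (Submodule.finrank_mono hker).trans (by
      simpa using finrank_span_le_card (R := k) ({fun _ => (1 : k)} : Set (Q.V → k)))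
  have h2 := LinearMap.finrank_range_add_finrank_ker D
  have h3 : LinearMap.range D = ⊤ := by
    apply Submodule.eq_top_of_finrank_eq
    apply le_antisymm (Submodule.finrank_le _)
    rw [Module.finrank_fintype_fun_eq_card] at *
    have h4 : Fintype.card T = T.ncard := by
      rw [Set.ncard_eq_toFinset_card', Set.toFinset_card]
    have := hT.2
    omega
  have h5 : ∀ a : Q.A, ∃ g : Q.V → k, ∀ c ∈ T, g (Q.src c) - g (Q.tgt c) = if a = c then 1 else 0 := by
    intro a
    obtain ⟨g, hg⟩ := LinearMap.range_eq_top.1 h3 (fun c => if a = c then 1 else 0)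
    exact ⟨g, fun c hc => congrFun hg ⟨c, hc⟩⟩
  choose f hf using h5
  refine ⟨fun a => if a ∈ T then f a else 0, fun a ha => by simp [ha], fun a c hc => ?_⟩
  by_cases ha : a ∈ T
  · simp only [ha, if_true]; exact hf a c hc
  · have : a ≠ c := by rintro rfl; exact ha hc
    simp [ha, this]

/-! ### Maximal paths -/

theorem max_of {S S' : Set (Q.A × Q.A)} (hg : Gtl Q S S')
    {x : PathDat Q × PathDat Q} (hm : Mem Q S S' x) (h1 : ¬ hEq x) (h2 : ¬ lEq x)
    (hne : x.1.2 ≠ []) (hL : ∀ b, ¬ Lc Q S S' b x) (hR : ∀ a, ¬ Rc Q S S' a x)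
    (q : PathDat Q) (hq : PG Q S q) (hi : x.1.2 <:+: q.2) : x.1.2 = q.2 := by
  obtain ⟨s, t, hst⟩ := hi
  obtain ⟨c, hc⟩ := some_head hne
  obtain ⟨d, hd⟩ := some_last hne
  have hch := hq.1
  rw [← hst, List.append_assoc, List.isChain_append] at hch
  obtain ⟨_, hch2, hs⟩ := hch
  rw [List.isChain_append] at hch2
  have ht := hch2.2.2
  obtain ⟨m1, m2, m3, m4⟩ := hm
  have hs0 : s = [] := by
    by_contra hs0
    obtain ⟨a, ha⟩ := some_last hs0
    have hac := hs a ha c (by rw [List.head?_append, hc]; simp)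
    refine hR a ⟨?_, fun e he => ?_, fun e he => ?_⟩
    · rw [← m1.2 c hc]; exact hg.comp hac
    · rw [Option.mem_def, hc] at he; cases he; exact hac
    · rcases hg.tot (a := a) (b := e) (by
        rw [m2.2 e he, hg.comp hac, m1.2 c hc]; exact m3) with h | h
      · exact absurd (hc.trans ((hg.fwd hac h) ▸ (Option.mem_def.1 he).symm)) h1
      · exact h
  have ht0 : t = [] := by
    by_contra ht0
    obtain ⟨b, hb⟩ := some_head ht0
    have hdb := ht d hd b hb
    have hdb' : Q.src b = ptgt Q x.1 := by rw [ptgt_last _ hd, hg.comp hdb]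
    refine hL b ⟨hdb', fun e he => ?_, fun e he => ?_⟩
    · rw [Option.mem_def, hd] at he; cases he; exact hdb
    · rcases hg.tot (a := e) (b := b) (by
        rw [hdb', m4, ptgt_last _ he]) with h | h
      · exact absurd (hd.trans ((hg.bwd hdb h) ▸ (Option.mem_def.1 he).symm)) h2
      · exact h
  rw [← hst, hs0, ht0]; simp

theorem noL_of_max {S S' : Set (Q.A × Q.A)} (hg : Gtl Q S S')
    {x : PathDat Q × PathDat Q} (hm : Mem Q S S' x) 
    (hmax : ∀ q : PathDat Q, PG Q S q → x.1.2 <:+: q.2 → x.1.2 = q.2) (b : Q.A) :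
    ¬ Lc Q S S' b x := by
  intro h
  have := hmax _ ((mem_xL hg b x).2 ⟨hm, h⟩).1 ⟨[], [b], by simp [xL, extL]⟩
  simp [xL, extL] at this

theorem noR_of_max {S S' : Set (Q.A × Q.A)} (hg : Gtl Q S S')
    {x : PathDat Q × PathDat Q} (hm : Mem Q S S' x) 
    (hmax : ∀ q : PathDat Q, PG Q S q → x.1.2 <:+: q.2 → x.1.2 = q.2) (a : Q.A) :
    ¬ Rc Q S S' a x := by
  intro h
  have := hmax _ ((mem_xR hg a x h.1 hm.2.2.1).2 ⟨hm, h⟩).1 ⟨[a], [], by simp [xR, extR]⟩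
  simp [xR, extR] at this

theorem d_none (hg : Gtl Q R (cpl Q R)) {m : ℕ} {x : PathDat Q × PathDat Q}
    (h : GBmem Q R m x) (hL : ∀ b, ¬ Lc Q R (cpl Q R) b x) (hR : ∀ a, ¬ Rc Q R (cpl Q R) a x) :
    dLin k Q R m (bv k Q R m x) = 0 := by
  rw [d_bv h, dL_zero hg hL, dR_zero hg h hR]; simp

theorem neg_pow_one {m : ℕ} : (-1 : k) ^ m = 1 ↔ Even m ∨ ringChar k = 2 := by
  constructor
  · intro h
    rcases Nat.even_or_odd m with he | ho
    · exact Or.inl he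
    · right
      rw [ho.neg_one_pow] at h
      have h2 : ((2 : ℕ) : k) = 0 := by
        push_cast
        linear_combination -h
      have := (ringChar.spec k 2).1 h2
      rcases (Nat.dvd_prime Nat.prime_two).1 this with h | h
      · exact absurd h (CharP.ringChar_ne_one)
      · exact h
  · rintro (h | h)
    · exact h.neg_one_pow
    · have h2 : ((2 : ℕ) : k) = 0 := (ringChar.spec k 2).2 (by rw [h])
      have : (-1 : k) = 1 := by push_cast at h2; linear_combination -h2
      rw [this, one_pow]

end
end GentleTT

namespace GentleTT

/-! ### Membership in the list of generators and the projection -/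

section
variable {k : Type} [Field k] {Q : Quiv} {R : Set (Q.A × Q.A)} {T : Set Q.A}
  {Sb Sg : Set (PathDat Q)} {τ : Q.A → Q.V → k}

theorem gen1 : oneD k Q R 0 ∈ GenAll k Q R T Sb Sg 0 := by
  exact Or.inl (Or.inl (Or.inl (Or.inl (Or.inl (Or.inl (Or.inl (⟨rfl, rfl⟩)))))))

theorem gen2 {α : PathDat Q} (h1 : BMax Q R α) (h2 : GBmem Q R 0 ((psrc Q α, []), α)) :
    bv k Q R 0 ((psrc Q α, []), α) ∈ GenAll k Q R T Sb Sg 0 := by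
  have : ∃ α' : PathDat Q, BMax Q R α' ∧ GBmem Q R 0 ((psrc Q α', []), α') ∧
    bv k Q R 0 ((psrc Q α, []), α) = bv k Q R 0 ((psrc Q α', []), α') := ⟨α, h1, h2, rfl⟩
  exact Or.inl (Or.inl (Or.inl (Or.inl (Or.inl (Or.inl (Or.inr ⟨rfl, this⟩))))))

theorem gen3 {α : PathDat Q} (h1 : α ∈ Sb) : cycB k Q R 0 α ∈ GenAll k Q R T Sb Sg 0 := by
  have : ∃ α' ∈ Sb, cycB k Q R 0 α = cycB k Q R 0 α' := ⟨α, h1, rfl⟩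
  exact Or.inl (Or.inl (Or.inl (Or.inl (Or.inl (Or.inr ⟨rfl, this⟩)))))

theorem gen4 {c : Q.A} (h1 : c ∉ T) : ea k R c ∈ GenAll k Q R T Sb Sg 1 := by
  have : ∃ c' : Q.A, c' ∉ T ∧ ea k R c =
    bv k Q R 1 ((Q.src c', [c']), (Q.src c', [c'])) := ⟨c, h1, rfl⟩
  exact Or.inl (Or.inl (Or.inl (Or.inl (Or.inr ⟨rfl, this⟩))))

theorem yB_form {p : PathDat Q} {S : Set (Q.A × Q.A)} (hp : Cmp Q S p) {c : Q.A}
    (hc : p.2.head? = some c) {m : ℕ} :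
    yB k R m p = bv k Q R m ((Q.src c, [c]), (p.1, p.2 ++ [c])) := by
  rw [yB_eq hc, hp.1.2 c hc]
  simp [xL, extL]

theorem yG_form {p : PathDat Q} {S : Set (Q.A × Q.A)} (hp : Cmp Q S p) {c : Q.A}
    (hc : p.2.head? = some c) {m : ℕ} :
    yG k R m p = bv k Q R m ((p.1, p.2 ++ [c]), (Q.src c, [c])) := by
  rw [yG_eq hc, hp.1.2 c hc]
  simp [xL, extL]

theorem gen5 {α : PathDat Q} (h1 : α ∈ Sb) {S : Set (Q.A × Q.A)} (hp : Cmp Q S α) :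
    yB k R 1 α ∈ GenAll k Q R T Sb Sg 1 := by
  obtain ⟨c, hc⟩ := some_head (cmp_ne hp)
  have : ∃ α' ∈ Sb, ∃ c : Q.A, α'.2.head? = some c ∧
       yB k R 1 α = bv k Q R 1 ((Q.src c, [c]), (α'.1, α'.2 ++ [c])) :=
    ⟨α, h1, c, hc, yB_form hp hc⟩
  exact Or.inl (Or.inl (Or.inl (Or.inr ⟨rfl, this⟩)))

theorem gen6 {m : ℕ} {γ α : PathDat Q} (h1 : GMax Q R γ) (h2 : GBmem Q R m (γ, α))
    (h3 : γ.2.head? ≠ α.2.head?) (h4 : γ.2.getLast? ≠ α.2.getLast?) :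
    bv k Q R m (γ, α) ∈ GenAll k Q R T Sb Sg m := by
  have : ∃ γ' α' : PathDat Q, GMax Q R γ' ∧ GBmem Q R m (γ', α') ∧
       γ'.2.head? ≠ α'.2.head? ∧ γ'.2.getLast? ≠ α'.2.getLast? ∧
       bv k Q R m (γ, α) = bv k Q R m (γ', α') := ⟨γ, α, h1, h2, h3, h4, rfl⟩
  exact Or.inl (Or.inl (Or.inr this))

theorem gen7 {m : ℕ} {C : PathDat Q} (h1 : C ∈ Sg) (h2 : plen Q C = m)
    (h3 : Even m ∨ ringChar k = 2) : cycG k Q R m C ∈ GenAll k Q R T Sb Sg m := by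
  have : ∃ C' ∈ Sg, plen Q C' = m ∧ cycG k Q R m C = cycG k Q R m C' := ⟨C, h1, h2, rfl⟩
  exact Or.inl (Or.inr ⟨h3, this⟩)

theorem gen8 {m : ℕ} {C : PathDat Q} (h1 : C ∈ Sg) {S : Set (Q.A × Q.A)} (hp : Cmp Q S C)
    (h2 : plen Q C = m) (h3 : Even m ∨ ringChar k = 2) :
    yG k R (m + 1) C ∈ GenAll k Q R T Sb Sg (m + 1) := by
  obtain ⟨c, hc⟩ := some_head (cmp_ne hp)
  have : ∃ C' ∈ Sg, ∃ b : Q.A, C'.2.head? = some b ∧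
       plen Q C' + 1 = m + 1 ∧ yG k R (m + 1) C =
        bv k Q R (m + 1) ((C'.1, C'.2 ++ [b]), (Q.src b, [b])) :=
    ⟨C, h1, c, hc, by rw [h2], yG_form hp hc⟩
  have h4 : Odd (m + 1) ∨ ringChar k = 2 := by
    rcases h3 with h | h
    · exact Or.inl h.add_one
    · exact Or.inr h
  exact Or.inr ⟨h4, this⟩

variable (k R Sb Sg τ) in
noncomputable def DH : (n : ℕ) → (Coch k Q R n →ₗ[k] Coch k Q R n)
  | 0 => 0
  | m + 1 => dLin k Q R m ∘ₗ hM k R Sb Sg τ m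

theorem DH_zero {n : ℕ} {w : PathDat Q × PathDat Q} (h : GBmem Q R n w) (h1 : ¬ lEq w)
    (h2 : ¬ hEq w) : DH k R Sb Sg τ n (bv k Q R n w) = 0 := by
  cases n with
  | zero => rfl
  | succ n =>
    simp only [DH, LinearMap.comp_apply]
    rw [hM_bv h, hB_FF h1 h2, map_zero]

theorem h_yB (hg : Gtl Q R (cpl Q R)) {p : PathDat Q} (h : Cmp Q (cpl Q R) p) :
    hM k R Sb Sg τ 0 (yB k R 1 p) = cycH Sb (uB k R 0) p := by
  obtain ⟨c, hc⟩ := some_head (cmp_ne h)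
  rw [yB_eq hc, hM_bv (gb_yB hg h hc), hB_E hc]
  rfl

open Classical in
theorem h_yG (hg : Gtl Q R (cpl Q R)) {p : PathDat Q} (h : Cmp Q R p) {m : ℕ}
    (hm : p.2.length = m) :
    hM k R Sb Sg τ m (yG k R (m + 1) p) = if (-1 : k) ^ m = 1 then cycH Sg (uG k R m) p
      else (2⁻¹ : k) • ∑ j ∈ Finset.range m, (-1 : k) ^ j • uG k R m (rotI Q j p) := by
  obtain ⟨c, hc⟩ := some_head (cmp_ne h)
  subst hm
  rw [yG_eq hc, hM_bv (gb_yG hg h hc), hB_F hc]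
  rfl

theorem cycB_sum {α : PathDat Q} :
    cycB k Q R 0 α = ∑ j ∈ Finset.range (periodP Q α), uB k R 0 (rotI Q j α) := rfl

theorem cycG_sum {α : PathDat Q} {m : ℕ} (hm : (-1 : k) ^ m = 1) :
    cycG k Q R m α = ∑ j ∈ Finset.range (periodP Q α), uG k R m (rotI Q j α) := by
  unfold cycG
  apply Finset.sum_congr rfl
  intro i _
  rw [Nat.mul_comm, pow_mul, hm, one_pow, one_smul]
  rfl

theorem rotI_succ (i : ℕ) (p : PathDat Q) : rotI Q (i + 1) p = rotP Q (rotI Q i p) :=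
  Function.iterate_succ_apply' _ _ _

theorem rotI_succ' (i : ℕ) (p : PathDat Q) : rotI Q (i + 1) p = rotI Q i (rotP Q p) :=
  Function.iterate_succ_apply _ _ _

theorem two_inv (h2 : (2 : k) ≠ 0) {M : Type} [AddCommGroup M] [Module k M] (u : M) :
    (2⁻¹ : k) • (u + u) = u := by
  rw [← two_smul k u, smul_smul, inv_mul_cancel₀ h2, one_smul]

theorem odd_case {m : ℕ} (h : ¬ (-1 : k) ^ m = 1) : (-1 : k) ^ m = -1 ∧ (2 : k) ≠ 0 := by
  rcases Nat.even_or_odd m with he | ho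
  · exact absurd he.neg_one_pow h
  · refine ⟨ho.neg_one_pow, fun h2 => h ?_⟩
    rw [ho.neg_one_pow]
    linear_combination -h2

/-- The telescoping sum for odd cycles. -/
theorem tele {M : Type} [AddCommGroup M] [Module k M] {m : ℕ} (h : ¬ (-1 : k) ^ m = 1)
    (f : ℕ → M) (hf : f m = f 0) :
    (2⁻¹ : k) • ∑ j ∈ Finset.range m, (-1 : k) ^ j • (f j + f (j + 1)) = f 0 := by
  obtain ⟨h1, h2⟩ := odd_case h
  have : ∀ j ∈ Finset.range m, (-1 : k) ^ j • (f j + f (j + 1)) =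
      (-1 : k) ^ j • f j - (-1 : k) ^ (j + 1) • f (j + 1) := by
    intro j _
    rw [smul_add, pow_succ]; simp
  rw [Finset.sum_congr rfl this, Finset.sum_range_sub' (fun j => (-1 : k) ^ j • f j)]
  rw [h1, hf, pow_zero, one_smul, neg_smul, one_smul, sub_neg_eq_add, two_inv h2]

theorem pi_vtx (hg : Gtl Q R (cpl Q R))
    (hT : IsSpanningTree Q T)
    (hV : Nonempty Q.V)
    (ht : ∀ a, ∀ c ∈ T, τ a (Q.src c) - τ a (Q.tgt c) = if a = c then 1 else 0)
    (v : Q.V) : ee k R v - hM k R Sb Sg τ 0 (dLin k Q R 0 (ee k R v)) ∈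
    Submodule.span k (GenAll k Q R T Sb Sg 0) := by
  have hh : ∀ a, hM k R Sb Sg τ 0 (ea k R a) = ∑ u, τ a u • ee k R u := by
    intro a
    rw [ea, hM_bv (gb_ea hg a), hB_arr]; rfl
  obtain ⟨v0⟩ := hV
  let co : Q.A → k := fun a => (if Q.src a = v then (1 : k) else 0) - (if Q.tgt a = v then 1 else 0)
  let g : Q.V → k := fun u => (if u = v then 1 else 0) - ∑ a, co a * τ a u
  have e1 : ee k R v - hM k R Sb Sg τ 0 (dLin k Q R 0 (ee k R v)) = ∑ u, g u • ee k R u := by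
    rw [d_ee hg, map_sum]
    have : ∀ a ∈ Finset.univ, hM k R Sb Sg τ 0 (co a • ea k R a) =
        ∑ u, (co a * τ a u) • ee k R u := by
      intro a _
      rw [map_smul, hh, Finset.smul_sum]
      simp only [smul_smul]
    rw [Finset.sum_congr rfl this, Finset.sum_comm]
    simp only [g, sub_smul, Finset.sum_sub_distrib, Finset.sum_smul]
    simp
  have e2 : ∀ u, g u = g v0 := by
    intro u
    apply tree_const hT g
    intro c hc
    have : (∑ a, co a * τ a (Q.src c)) - ∑ a, co a * τ a (Q.tgt c) = co c := by
      rw [← Finset.sum_sub_distrib]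
      simp only [← mul_sub, ht _ c hc]
      simp
    simp only [co] at this
    simp only [g, co]
    linear_combination -this
  rw [e1]
  simp only [e2]
  rw [← Finset.smul_sum]
  exact Submodule.smul_mem _ _ (Submodule.subset_span gen1)

theorem pi_arr (hg : Gtl Q R (cpl Q R))
    (ht : ∀ a, ∀ c ∈ T, τ a (Q.src c) - τ a (Q.tgt c) = if a = c then 1 else 0)
    (a : Q.A) : ea k R a - dLin k Q R 0 (hM k R Sb Sg τ 0 (ea k R a)) ∈
    Submodule.span k (GenAll k Q R T Sb Sg 1) := by
  have hh : hM k R Sb Sg τ 0 (ea k R a) = ∑ u, τ a u • ee k R u := by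
    rw [ea, hM_bv (gb_ea hg a), hB_arr]; rfl
  have e1 : ea k R a - dLin k Q R 0 (hM k R Sb Sg τ 0 (ea k R a)) =
      ∑ c, ((if a = c then 1 else 0) - (τ a (Q.src c) - τ a (Q.tgt c))) • ea k R c := by
    rw [hh, map_sum]
    simp only [map_smul, d_ee hg, Finset.smul_sum, smul_smul]
    rw [Finset.sum_comm]
    simp only [sub_smul, Finset.sum_sub_distrib]
    congr 1
    · simp
    · simp only [mul_sub, sub_smul, Finset.sum_sub_distrib, ← Finset.sum_smul]
      simp
  rw [e1]
  apply Submodule.sum_mem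
  intro c _
  by_cases hc : c ∈ T
  · rw [ht a c hc]; simp
  · exact Submodule.smul_mem _ _ (Submodule.subset_span (gen4 hc))

theorem lEq_nil {x : PathDat Q × PathDat Q} (ht : ¬ Triv x) (h : x.1.2 = [] ∨ x.2.2 = []) :
    ¬ lEq x ∧ ¬ hEq x := by
  unfold lEq hEq
  unfold Triv at ht
  rcases h with h | h
  · have : x.2.2 ≠ [] := fun e => ht ⟨h, e⟩
    simp [h, this, eq_comm]
  · have : x.1.2 ≠ [] := fun e => ht ⟨e, h⟩
    simp [h, this]

theorem core_gen (hg : Gtl Q R (cpl Q R))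
    {n : ℕ} {w : PathDat Q × PathDat Q} (h : GBmem Q R n w)
    (hx : Core Q R (cpl Q R) w)
    (hL : ∀ b, ¬ Lc Q R (cpl Q R) b w) (hR : ∀ a, ¬ Rc Q R (cpl Q R) a w) :
    bv k Q R n w ∈ GenAll k Q R T Sb Sg n := by
  by_cases h1 : w.1.2 = []
  · have hne : w.2.2 ≠ [] := fun e => hx.not_triv ⟨h1, e⟩
    obtain rfl : n = 0 := by
      rw [← ((GBmem_iff hg _ _).1 h).2, h1]; rfl
    have hf : w = ((psrc Q w.2, []), w.2) := nil_form hx.1 h1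
    have hmax : BMax Q R w.2 := by
      refine ⟨(InB_iff _).2 hx.1.2.1, fun q hq hi => ?_⟩
      exact max_of hg.swap hx.swap.1 hx.swap.2.1 hx.swap.2.2.1 hne
        (fun b hb => hL b (hb.swap hx.swap.1)) (fun b hb => hR b (hb.swap hx.swap.1)) q
        ((InB_iff _).1 hq) hi
    rw [hf] at h ⊢
    exact gen2 hmax h
  · apply gen6 (γ := w.1) (α := w.2) _ h hx.2.1 hx.2.2.1
    refine ⟨(InG_iff hg.comp _).2 hx.1.1, fun q hq hi => ?_⟩
    exact max_of hg hx.1 hx.2.1 hx.2.2.1 h1 hL hR q ((InG_iff hg.comp _).1 hq) hi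

theorem pi_uB (hg : Gtl Q R (cpl Q R))
    (hb : RepSys Q (cpl Q R) Sb)
    {p : PathDat Q} (hp : Cmp Q (cpl Q R) p) :
    uB k R 0 p - hM k R Sb Sg τ 0 (dLin k Q R 0 (uB k R 0 p)) ∈
      Submodule.span k (GenAll k Q R T Sb Sg 0) := by
  rw [d_uB hg hp]
  rcases cycH_u hg.comp' hg.fwd' hb (hM k R Sb Sg τ 0) (uB k R 0) (yB k R 1) hp
    (fun i => h_yB hg (rotI_cmp hp hg.comp' hg.fwd' i).1) with h | h
  · change uB k R 0 p - hM k R Sb Sg τ 0 (yB k R 1 p - yB k R 1 (rotP Q p)) = 0 at h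
    rw [h]; simp
  · change uB k R 0 p - hM k R Sb Sg τ 0 (yB k R 1 p - yB k R 1 (rotP Q p)) = _ at h
    rw [h, ← cycB_sum]
    exact Submodule.subset_span (gen3 (rp_spec hg.comp' hg.fwd' hb hp).1)

theorem pi_yB (hg : Gtl Q R (cpl Q R))
    (hb : RepSys Q (cpl Q R) Sb)
    {p : PathDat Q} (hp : Cmp Q (cpl Q R) p) :
    yB k R 1 p - dLin k Q R 0 (hM k R Sb Sg τ 0 (yB k R 1 p)) ∈
      Submodule.span k (GenAll k Q R T Sb Sg 1) := by
  have hr := rp_spec hg.comp' hg.fwd' hb hp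
  have hrc := hb.cmp _ hr.1
  rw [h_yB hg hp, cycH_y hg.comp' hg.fwd' hb (dLin k Q R 0) (uB k R 0) (yB k R 1) hp]
  · exact Submodule.subset_span (gen5 hr.1 hrc)
  · intro i
    rw [d_uB hg (rotI_cmp hrc hg.comp' hg.fwd' i).1, rotI_succ]

theorem pi_uG (hg : Gtl Q R (cpl Q R))
    (hs : RepSys Q R Sg)
    {p : PathDat Q} (hp : Cmp Q R p) {m : ℕ} (hm : p.2.length = m) :
    uG k R m p - hM k R Sb Sg τ m (dLin k Q R m (uG k R m p)) ∈
      Submodule.span k (GenAll k Q R T Sb Sg m) := by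
  have hrot : ∀ i, Cmp Q R (rotI Q i p) ∧ (rotI Q i p).2.length = m := fun i => by
    have := rotI_cmp hp hg.comp hg.fwd i
    exact ⟨this.1, this.2.trans hm⟩
  rw [d_uG hg hp hm]
  by_cases h1 : (-1 : k) ^ m = 1
  · rw [h1, one_smul]
    rcases cycH_u hg.comp hg.fwd hs (hM k R Sb Sg τ m) (uG k R m) (yG k R (m + 1)) hp
      (fun i => by rw [h_yG hg (hrot i).1 (hrot i).2, if_pos h1]) with h | h
    · change uG k R m p - hM k R Sb Sg τ m (yG k R (m + 1) p - yG k R (m + 1) (rotP Q p)) = 0 at h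
      rw [h]; simp
    · change uG k R m p - hM k R Sb Sg τ m (yG k R (m + 1) p - yG k R (m + 1) (rotP Q p)) = _ at h
      rw [h, ← cycG_sum h1]
      have hr := rp_spec hg.comp hg.fwd hs hp
      refine Submodule.subset_span (gen7 hr.1 ?_ (neg_pow_one.1 h1))
      unfold plen
      rw [← hm]
      conv_rhs => rw [← hr.2.2]
      exact (rotI_cmp (hs.cmp _ hr.1) hg.comp hg.fwd _).2.symm
  · have e := odd_case h1
    have hr1 := hrot 1
    rw [e.1, map_sub, map_smul, h_yG hg hp hm, if_neg h1,
      h_yG hg (p := rotP Q p) hr1.1 hr1.2, if_neg h1]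
    have := tele h1 (fun j => uG k R m (rotI Q j p)) (by
      have e0 : rotI Q m p = p := by rw [← hm]; exact rotI_len hp hg.comp hg.fwd
      change uG k R m (rotI Q m p) = uG k R m p
      rw [e0])
    simp only [smul_add, Finset.sum_add_distrib, rotI_succ'] at this
    rw [neg_smul, one_smul, sub_neg_eq_add, this]
    change uG k R m p - uG k R m p ∈ _
    simp

theorem pi_yG (hg : Gtl Q R (cpl Q R))
    (hs : RepSys Q R Sg)
    {p : PathDat Q} (hp : Cmp Q R p) {m : ℕ} (hm : p.2.length = m) :
    yG k R (m + 1) p - dLin k Q R m (hM k R Sb Sg τ m (yG k R (m + 1) p)) ∈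
      Submodule.span k (GenAll k Q R T Sb Sg (m + 1)) := by
  have hrot : ∀ i, Cmp Q R (rotI Q i p) ∧ (rotI Q i p).2.length = m := fun i => by
    have := rotI_cmp hp hg.comp hg.fwd i
    exact ⟨this.1, this.2.trans hm⟩
  rw [h_yG hg hp hm]
  by_cases h1 : (-1 : k) ^ m = 1
  · rw [if_pos h1]
    have hr := rp_spec hg.comp hg.fwd hs hp
    have hrc := hs.cmp _ hr.1
    have hlen : (rp Sg p).1.2.length = m := by
      rw [← hm]
      conv_rhs => rw [← hr.2.2]
      exact (rotI_cmp hrc hg.comp hg.fwd _).2.symm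
    rw [cycH_y hg.comp hg.fwd hs (dLin k Q R m) (uG k R m) (yG k R (m + 1)) hp]
    · exact Submodule.subset_span (gen8 hr.1 hrc hlen (neg_pow_one.1 h1))
    · intro i
      have := rotI_cmp hrc hg.comp hg.fwd i
      rw [d_uG hg this.1 (this.2.trans hlen), rotI_succ, h1, one_smul]
  · rw [if_neg h1, map_smul, map_sum]
    have e := odd_case h1
    have h3 : ∀ j ∈ Finset.range m, dLin k Q R m ((-1 : k) ^ j • uG k R m (rotI Q j p)) =
        (-1 : k) ^ j • (yG k R (m + 1) (rotI Q j p) + yG k R (m + 1) (rotI Q (j + 1) p)) := by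
      intro j _
      rw [map_smul, d_uG hg (hrot j).1 (hrot j).2, e.1, rotI_succ, neg_smul, one_smul,
        sub_neg_eq_add]
    rw [Finset.sum_congr rfl h3, tele h1 (fun j => yG k R (m + 1) (rotI Q j p)) (by
      have e0 : rotI Q m p = p := by rw [← hm]; exact rotI_len hp hg.comp hg.fwd
      change yG k R (m + 1) (rotI Q m p) = yG k R (m + 1) p
      rw [e0])]
    change yG k R (m + 1) p - yG k R (m + 1) p ∈ _
    simp

theorem pi_bv (hg : Gtl Q R (cpl Q R))
    (hT : IsSpanningTree Q T)
    (hV : Nonempty Q.V)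
    (hb : RepSys Q (cpl Q R) Sb)
    (hs : RepSys Q R Sg)
    (ht : ∀ a, ∀ c ∈ T, τ a (Q.src c) - τ a (Q.tgt c) = if a = c then 1 else 0)
    {n : ℕ} {w : PathDat Q × PathDat Q} (h : GBmem Q R n w) :
    bv k Q R n w - DH k R Sb Sg τ n (bv k Q R n w) -
      hM k R Sb Sg τ n (dLin k Q R n (bv k Q R n w)) ∈
      Submodule.span k (GenAll k Q R T Sb Sg n) := by
  obtain ⟨hm, hn⟩ := (GBmem_iff hg _ _).1 h
  have hcl := classify hg hm
  cases hcl with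
  | vtx v =>
    subst hn
    have := pi_vtx (Sb := Sb) (Sg := Sg) hg hT hV ht v
    change ee k R v - 0 - hM k R Sb Sg τ 0 (dLin k Q R 0 (ee k R v)) ∈
      Submodule.span k (GenAll k Q R T Sb Sg 0)
    rwa [sub_zero]
  | arr a =>
    subst hn
    have := pi_arr (Sb := Sb) (Sg := Sg) hg ht a
    change ea k R a - dLin k Q R 0 (hM k R Sb Sg τ 0 (ea k R a)) -
      hM k R Sb Sg τ 1 (dLin k Q R 1 (ea k R a)) ∈ Submodule.span k (GenAll k Q R T Sb Sg 1)
    rwa [d_ea hg, map_zero, sub_zero]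
  | cycB p hp =>
    subst hn
    have := pi_uB (T := T) (Sg := Sg) (τ := τ) hg hb hp
    change uB k R 0 p - 0 - hM k R Sb Sg τ 0 (dLin k Q R 0 (uB k R 0 p)) ∈
      Submodule.span k (GenAll k Q R T Sb Sg 0)
    rwa [sub_zero]
  | cycG p hp =>
    have hlh := lEq_nil (x := (p, (p.1, []))) (fun e => cmp_ne hp e.1) (Or.inr rfl)
    rw [DH_zero h hlh.1 hlh.2, sub_zero]
    exact pi_uG hg hs hp hn
  | core _ hx =>
    rw [DH_zero h hx.2.2.1 hx.2.1, sub_zero]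
    by_cases hb : ∃ b, Lc Q R (cpl Q R) b w <;> by_cases ha : ∃ a, Rc Q R (cpl Q R) a w
    · obtain ⟨b, hb⟩ := hb
      obtain ⟨a, ha⟩ := ha
      rw [d_bv h, dL_eq hg hx.not_triv hb, dR_eq hg h hx.not_triv ha, map_sub, map_smul,
        hM_bv (gb_L hg h hb), hM_bv (gb_R hg h ha), hB_L hg hx hb, hB_R0 hg hx ha hb]
      simp
    · obtain ⟨b, hb⟩ := hb
      push Not at ha
      rw [d_bv h, dL_eq hg hx.not_triv hb, dR_zero hg h ha, map_sub, map_smul,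
        hM_bv (gb_L hg h hb), hB_L hg hx hb]
      simp
    · obtain ⟨a, ha⟩ := ha
      push Not at hb
      rw [d_bv h, dL_zero hg hb, dR_eq hg h hx.not_triv ha, map_sub, map_smul,
        hM_bv (gb_R hg h ha), hB_R hg hx ha hb]
      simp [smul_smul, ← mul_pow]
    · push Not at ha hb
      rw [d_none hg h hb ha, map_zero, sub_zero]
      exact Submodule.subset_span (core_gen hg h hx hb ha)
  | coreL x hx b hb =>
    obtain ⟨n, rfl⟩ : ∃ j, n = j + 1 := ⟨x.1.2.length, by rw [← hn]; simp [xL, extL]⟩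
    have hx' := ((gb_xL hg).1 h).1
    simp only [DH, LinearMap.comp_apply]
    rw [hM_bv h, hB_L hg hx hb, d_bv hx', dL_eq hg hx.not_triv hb]
    by_cases ha : ∃ a, Rc Q R (cpl Q R) a x
    · obtain ⟨a, ha⟩ := ha
      rw [d_L_R hg hx' hx hb ha, map_smul, hM_bv (gb_LR hg hx' hx hb ha), hB_LR,
        dR_eq hg hx' hx.not_triv ha]
      simp
    · push Not at ha
      rw [d_L_nR hg hx' hb ha, map_zero, dR_zero hg hx' ha]
      simp
  | coreR x hx a ha =>
    have hx' : GBmem Q R x.1.2.length x := (GBmem_iff hg _ _).2 ⟨hx.1, rfl⟩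
    obtain rfl : n = x.1.2.length + 1 := by rw [← hn]; simp [xR, extR]
    simp only [DH, LinearMap.comp_apply]
    rw [hM_bv h]
    by_cases hb : ∃ b, Lc Q R (cpl Q R) b x
    · obtain ⟨b, hb⟩ := hb
      rw [d_R_L hg hx' hx hb ha, hB_R0 hg hx ha hb, hM_bv (gb_LR hg hx' hx hb ha), hB_LR]
      simp
    · push Not at hb
      rw [d_R_nL hg hx' hb ha, hB_R hg hx ha hb, map_neg, map_smul, d_bv hx', dL_zero hg hb,
        dR_eq hg hx' hx.not_triv ha]
      simp [smul_smul, ← mul_pow]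
  | coreLR x hx a b hb ha =>
    have hx' : GBmem Q R x.1.2.length x := (GBmem_iff hg _ _).2 ⟨hx.1, rfl⟩
    obtain rfl : n = x.1.2.length + 2 := by rw [← hn]; simp [xR, extR, xL, extL]
    simp only [DH, LinearMap.comp_apply]
    rw [d_LR hg hx' hx hb ha, map_zero, hM_bv h, hB_LR, d_R_L hg hx' hx hb ha]
    simp
  | cycB' p hp c hc =>
    obtain rfl : n = 1 := by rw [← hn]; simp [xL, extL]
    rw [← yB_eq hc, d_yB hg hp, map_zero, sub_zero]
    exact pi_yB hg hb hp
  | cycG' p hp c hc =>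
    obtain rfl : n = p.2.length + 1 := by rw [← hn]; simp [xL, extL]
    rw [← yG_eq hc, d_yG hg hp rfl, map_zero, sub_zero]
    exact pi_yG hg hs hp rfl

theorem pi_all (hg : Gtl Q R (cpl Q R))
    (hT : IsSpanningTree Q T)
    (hV : Nonempty Q.V)
    (hb : RepSys Q (cpl Q R) Sb)
    (hs : RepSys Q R Sg)
    (ht : ∀ a, ∀ c ∈ T, τ a (Q.src c) - τ a (Q.tgt c) = if a = c then 1 else 0)
    {n : ℕ} (z : Coch k Q R n) :
    z - DH k R Sb Sg τ n z - hM k R Sb Sg τ n (dLin k Q R n z) ∈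
      Submodule.span k (GenAll k Q R T Sb Sg n) := by
  have := coch_mem (f := LinearMap.id - DH k R Sb Sg τ n - hM k R Sb Sg τ n ∘ₗ dLin k Q R n)
    (P := Submodule.span k (GenAll k Q R T Sb Sg n))
    (fun w hw => by simpa using pi_bv hg hT hV hb hs ht hw) z
  simpa using this

end
end GentleTT

namespace GentleTT

/-! ### The generators are cocycles killed by the homotopy -/

section
variable {k : Type} [Field k] {Q : Quiv} {R : Set (Q.A × Q.A)} {T : Set Q.A}
  {Sb Sg : Set (PathDat Q)} {τ : Q.A → Q.V → k}

/-- A reformulation of the list of generators. -/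
inductive GT (k : Type) [Field k] (Q : Quiv) (R : Set (Q.A × Q.A)) (T : Set Q.A)
    (Sb Sg : Set (PathDat Q)) : (n : ℕ) → Coch k Q R n → Prop
  | one : GT k Q R T Sb Sg 0 (oneD k Q R 0)
  | bmax (α : PathDat Q) (hp : GBmem Q R 0 ((α.1, []), α))
      (h : ∀ q : PathDat Q, PG Q (cpl Q R) q → α.2 <:+: q.2 → α.2 = q.2) :
      GT k Q R T Sb Sg 0 (bv k Q R 0 ((α.1, []), α))
  | cycB (α : PathDat Q) (h : α ∈ Sb) : GT k Q R T Sb Sg 0 (cycB k Q R 0 α)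
  | arr (c : Q.A) (h : c ∉ T) : GT k Q R T Sb Sg 1 (ea k R c)
  | cycB' (α : PathDat Q) (h : α ∈ Sb) : GT k Q R T Sb Sg 1 (yB k R 1 α)
  | gmax (n : ℕ) (w : PathDat Q × PathDat Q) (hw : GBmem Q R n w) (h1 : ¬ lEq w) (h2 : ¬ hEq w)
      (h : ∀ q : PathDat Q, PG Q R q → w.1.2 <:+: q.2 → w.1.2 = q.2) :
      GT k Q R T Sb Sg n (bv k Q R n w)
  | cycG (n : ℕ) (C : PathDat Q) (h : C ∈ Sg) (hn : C.2.length = n) (h1 : (-1 : k) ^ n = 1) :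
      GT k Q R T Sb Sg n (cycG k Q R n C)
  | cycG' (n : ℕ) (C : PathDat Q) (h : C ∈ Sg) (hn : C.2.length = n) (h1 : (-1 : k) ^ n = 1) :
      GT k Q R T Sb Sg (n + 1) (yG k R (n + 1) C)

theorem GT_of (hg : Gtl Q R (cpl Q R)) (hb : RepSys Q (cpl Q R) Sb) (hs : RepSys Q R Sg)
    {n : ℕ} {x : Coch k Q R n} (hx : x ∈ GenAll k Q R T Sb Sg n) :
    GT k Q R T Sb Sg n x := by
  rcases hx with ((((((h | h) | h) | h) | h) | h) | h) | h
  · obtain ⟨rfl, rfl⟩ := h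
    exact GT.one
  · obtain ⟨rfl, α, h1, h2, rfl⟩ := h
    exact GT.bmax α h2 fun q hq => h1.2 q ((InB_iff _).2 hq)
  · obtain ⟨rfl, α, h1, rfl⟩ := h
    exact GT.cycB α h1
  · obtain ⟨rfl, c, h1, rfl⟩ := h
    exact GT.arr c h1
  · obtain ⟨rfl, α, h1, c, hc, rfl⟩ := h
    rw [← yB_form (hb.cmp _ h1) hc]
    exact GT.cycB' α h1
  · obtain ⟨γ, α, h1, h2, h3, h4, rfl⟩ := h
    exact GT.gmax _ _ h2 h4 h3 fun q hq => h1.2 q ((InG_iff hg.comp _).2 hq)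
  · obtain ⟨h1, C, h2, h3, rfl⟩ := h
    exact GT.cycG _ C h2 h3 (neg_pow_one.2 h1)
  · obtain ⟨h1, C, h2, c, hc, rfl, rfl⟩ := h
    rw [← yG_form (hs.cmp _ h2) hc]
    refine GT.cycG' _ C h2 rfl (neg_pow_one.2 ?_)
    rcases h1 with h1 | h1
    · left
      have := Nat.not_even_iff_odd.2 h1
      rw [Nat.even_add_one, not_not] at this
      exact this
    · exact Or.inr h1

theorem rotI_period {S : Set (Q.A × Q.A)} (hc : ∀ {a b}, (a, b) ∈ S → Q.tgt a = Q.src b)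
    (hf : ∀ {a b b'}, (a, b) ∈ S → (a, b') ∈ S → b = b') {p : PathDat Q} (h : Cmp Q S p) :
    rotI Q (periodP Q p) p = p ∧ 0 < periodP Q p := by
  rw [periodP_eq p (cmp_periodic hc hf h)]
  exact ⟨Function.iterate_minimalPeriod,
    Function.minimalPeriod_pos_of_mem_periodicPts (cmp_periodic hc hf h)⟩

theorem d_one (hg : Gtl Q R (cpl Q R)) : dLin k Q R 0 (oneD k Q R 0) = 0 := by
  have : oneD k Q R 0 = ∑ v, ee k R v := rfl
  rw [this, map_sum]
  simp only [d_ee hg]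
  rw [Finset.sum_comm]
  simp only [← Finset.sum_smul, Finset.sum_sub_distrib]
  simp

theorem GT_d (hg : Gtl Q R (cpl Q R)) (hb : RepSys Q (cpl Q R) Sb) (hs : RepSys Q R Sg)
    {n : ℕ} {x : Coch k Q R n} (hx : GT k Q R T Sb Sg n x) : dLin k Q R n x = 0 := by
  cases hx with
  | one => exact d_one hg
  | bmax α hp h =>
    have hm := ((GBmem_iff hg _ _).1 hp).1
    exact d_none hg hp
      (fun b h' => noL_of_max hg.swap hm.swap h b (h'.swap hm))
      (fun b h' => noR_of_max hg.swap hm.swap h b (h'.swap hm))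
  | cycB α h =>
    have hc := hb.cmp _ h
    rw [cycB_sum, map_sum]
    have e : ∀ i ∈ Finset.range (periodP Q α), dLin k Q R 0 (uB k R 0 (rotI Q i α)) =
        yB k R 1 (rotI Q i α) - yB k R 1 (rotI Q (i + 1) α) := by
      intro i _
      rw [d_uB hg (rotI_cmp hc hg.comp' hg.fwd' i).1, rotI_succ]
    rw [Finset.sum_congr rfl e, Finset.sum_range_sub' (fun i => yB k R 1 (rotI Q i α)),
      (rotI_period hg.comp' hg.fwd' hc).1]
    exact sub_self _
  | arr c h => exact d_ea hg c
  | cycB' α h => exact d_yB hg (hb.cmp _ h)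
  | gmax _ w hw h1 h2 h =>
    have hm := ((GBmem_iff hg _ _).1 hw).1
    exact d_none hg hw (noL_of_max hg hm h) (noR_of_max hg hm h)
  | cycG _ α h hn h1 =>
    have hc := hs.cmp _ h
    rw [cycG_sum h1, map_sum]
    have e : ∀ i ∈ Finset.range (periodP Q α), dLin k Q R n (uG k R n (rotI Q i α)) =
        yG k R (n + 1) (rotI Q i α) - yG k R (n + 1) (rotI Q (i + 1) α) := by
      intro i _
      have := rotI_cmp hc hg.comp hg.fwd i
      rw [d_uG hg this.1 (this.2.trans hn), rotI_succ, h1, one_smul]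
    rw [Finset.sum_congr rfl e, Finset.sum_range_sub' (fun i => yG k R (n + 1) (rotI Q i α)),
      (rotI_period hg.comp hg.fwd hc).1]
    exact sub_self _
  | cycG' n C h hn h1 => exact d_yG hg (hs.cmp _ h) hn

theorem cycH_rep {S : Set (Q.A × Q.A)} (hc : ∀ {a b}, (a, b) ∈ S → Q.tgt a = Q.src b)
    (hf : ∀ {a b b'}, (a, b) ∈ S → (a, b') ∈ S → b = b') {S0 : Set (PathDat Q)}
    (hS : RepSys Q S S0) {q : PathDat Q} (hq : q ∈ S0) {M : Type} [AddCommGroup M]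
    (u : PathDat Q → M) : cycH S0 u q = 0 := by
  have := rp_eq hc hf hS hq (rotI_period hc hf (hS.cmp _ hq)).2
  change rp S0 q = (q, 0) at this
  unfold cycH
  rw [this]
  simp

theorem GT_h (hg : Gtl Q R (cpl Q R)) (hb : RepSys Q (cpl Q R) Sb) (hs : RepSys Q R Sg)
    (hτ : ∀ a, a ∉ T → τ a = 0)
    {n : ℕ} {x : Coch k Q R (n + 1)} (hx : GT k Q R T Sb Sg (n + 1) x) :
    hM k R Sb Sg τ n x = 0 := by
  cases hx with
  | arr c h =>
    rw [ea, hM_bv (gb_ea hg c), hB_arr, hτ c h]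
    simp
  | cycB' α h =>
    rw [h_yB hg (hb.cmp _ h), cycH_rep hg.comp' hg.fwd' hb h]
  | gmax _ w hw h1 h2 h => rw [hM_bv hw, hB_FF h1 h2]
  | cycG _ α h hn h1 =>
    have hc := hs.cmp _ h
    rw [cycG_sum h1, map_sum]
    apply Finset.sum_eq_zero
    intro i _
    have := rotI_cmp hc hg.comp hg.fwd i
    have hG := gb_uG hg this.1
    rw [this.2.trans hn] at hG
    have hl := lEq_nil (x := (rotI Q i α, ((rotI Q i α).1, []))) (fun e => cmp_ne this.1 e.1)
      (Or.inr rfl)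
    rw [uG, hM_bv hG, hB_FF hl.1 hl.2]
  | cycG' n C h hn h1 =>
    rw [h_yG hg (hs.cmp _ h) hn, if_pos h1, cycH_rep hg.comp hg.fwd hs h]

/-! ### Linear independence -/

theorem indep_of_supp {ι : Type} (Gen : Set (ι →₀ k)) (h0 : ∀ x ∈ Gen, x ≠ 0)
    (hd : ∀ x ∈ Gen, ∀ y ∈ Gen, ∀ w, x w ≠ 0 → y w ≠ 0 → x = y) :
    LinearIndependent k (fun x : Gen => (x : ι →₀ k)) := by
  rw [linearIndependent_iff']
  intro s g hsum i hi
  obtain ⟨w, hw⟩ := Finsupp.ne_iff.1 (h0 i i.2)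
  have h1 := DFunLike.congr_fun hsum w
  rw [Finsupp.finsetSum_apply, Finset.sum_eq_single i] at h1
  · simpa [show (i : ι →₀ k) w ≠ 0 from hw] using h1
  · intro j _ hj
    have : (j : ι →₀ k) w = 0 := by
      by_contra hne
      exact hj (Subtype.ext (hd _ j.2 _ i.2 w hne hw))
    simp [this]
  · intro h; exact absurd hi h

open Classical in
theorem bv_apply {n : ℕ} {w : PathDat Q × PathDat Q} (h : GBmem Q R n w) (v : GB Q R n) :
    bv k Q R n w v = if v.1 = w then 1 else 0 := by
  rw [bv_of h, Finsupp.single_apply]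
  congr 1
  rw [eq_iff_iff, Subtype.ext_iff, eq_comm]

theorem bv_supp {n : ℕ} {w : PathDat Q × PathDat Q} {v : GB Q R n}
    (hv : bv k Q R n w v ≠ 0) : v.1 = w := by
  classical
  by_cases h : GBmem Q R n w
  · rw [bv_apply h] at hv
    by_contra hne
    exact hv (if_neg hne)
  · rw [bv_not h] at hv
    exact absurd rfl hv

theorem bv_ne {n : ℕ} {w : PathDat Q × PathDat Q} (h : GBmem Q R n w) : bv k Q R n w ≠ 0 := by
  rw [bv_of h]
  simp

open Classical in
variable (k R Sb Sg) in
noncomputable def GG (n : ℕ) (w : PathDat Q × PathDat Q) : Coch k Q R n :=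
  if Triv w then oneD k Q R n
  else if w.1.2 = [] ∧ Cmp Q (cpl Q R) w.2 then cycB k Q R n (rp Sb w.2).1
  else if w.2.2 = [] ∧ Cmp Q R w.1 then cycG k Q R n (rp Sg w.1).1
  else bv k Q R n w

theorem GG_bv {n : ℕ} {w : PathDat Q × PathDat Q} (h1 : ¬ Triv w)
    (h2 : w.1.2 = [] → ¬ Cmp Q (cpl Q R) w.2) (h3 : w.2.2 = [] → ¬ Cmp Q R w.1) :
    GG k R Sb Sg n w = bv k Q R n w := by
  unfold GG
  rw [if_neg h1, if_neg (fun h => h2 h.1 h.2), if_neg (fun h => h3 h.1 h.2)]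

/-- A maximal path is not a full cycle. -/
theorem max_not_cmp {S : Set (Q.A × Q.A)} (hc : ∀ {a b}, (a, b) ∈ S → Q.tgt a = Q.src b)
    {p : PathDat Q} (hmax : ∀ q : PathDat Q, PG Q S q → p.2 <:+: q.2 → p.2 = q.2) :
    ¬ Cmp Q S p := by
  intro h
  have h2 := ((cmp_iff_sq hc p).2 h).2
  have := hmax _ h2 ⟨[], p.2, by simp [powP, powL]⟩
  have h3 := congrArg List.length this
  have h4 := cmp_ne h
  simp [powP, powL] at h3
  exact h4 h3

theorem no_arrow {S : Set (Q.A × Q.A)} {l : List Q.A} (hl : l = [])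
    (hmax : ∀ q : PathDat Q, PG Q S q → l <:+: q.2 → l = q.2) (a : Q.A) : False := by
  have := hmax (Q.src a, [a]) ⟨by simp, by simp⟩ (by simp [hl])
  simp [hl] at this

theorem GT_G (hg : Gtl Q R (cpl Q R)) (hb : RepSys Q (cpl Q R) Sb) (hs : RepSys Q R Sg)
    (hcon : Connected Q)
    {n : ℕ} {x : Coch k Q R n} (hx : GT k Q R T Sb Sg n x) (w : GB Q R n) (hw : x w ≠ 0) :
    x = GG k R Sb Sg n w.1 := by
  cases hx with
  | one =>
    rw [oneD, Finsupp.finsetSum_apply] at hw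
    obtain ⟨v, _, hv⟩ := Finset.exists_ne_zero_of_sum_ne_zero hw
    rw [bv_supp hv, GG, if_pos ⟨rfl, rfl⟩]
  | bmax α hp h =>
    rw [bv_supp hw]
    by_cases h1 : α.2 = []
    · have hV : ∀ v, v = α.1 := by
        intro v
        induction hcon α.1 v with
        | refl => rfl
        | tail _ hab _ => exact (no_arrow h1 h hab.choose).elim
      rw [GG, if_pos ⟨rfl, h1⟩, oneD, Finset.sum_eq_single α.1]
      · congr 1
        exact Prod.ext rfl (Prod.ext rfl h1)
      · intro v _ hv; exact absurd (hV v) hv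
      · simp
    · rw [GG_bv (fun e => h1 e.2) (fun _ => max_not_cmp hg.comp' h) (fun e => absurd e h1)]
  | cycB α h =>
    have hc := hb.cmp _ h
    rw [GentleTT.cycB, Finsupp.finsetSum_apply] at hw
    obtain ⟨i, hi, hv⟩ := Finset.exists_ne_zero_of_sum_ne_zero hw
    have hr := (rotI_cmp hc hg.comp' hg.fwd' i).1
    rw [bv_supp hv, GG, if_neg (fun e => cmp_ne hr e.2), if_pos ⟨rfl, hr⟩]
    simp only
    rw [rp_eq hg.comp' hg.fwd' hb h (Finset.mem_range.1 hi)]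
  | arr c h =>
    rw [bv_supp hw, GG_bv (by simp [Triv]) (by simp) (by simp)]
    rfl
  | cycB' α h =>
    obtain ⟨c, hc⟩ := some_head (cmp_ne (hb.cmp _ h))
    rw [yB_eq hc] at hw ⊢
    rw [bv_supp hw, GG_bv (by simp [Triv, xL, extL]) (by simp [xL, extL]) (by simp [xL, extL])]
  | gmax _ v hv h1 h2 h =>
    rw [bv_supp hw]
    have hne : v.1.2 ≠ [] := by
      intro e
      cases e2 : v.2.2 with
      | nil => exact h2 (by simp [hEq, e, e2])
      | cons a l => exact no_arrow e h a
    rw [GG_bv (fun e => hne e.1) (fun e => absurd e hne) (fun _ => max_not_cmp hg.comp h)]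
  | cycG _ α h hn h1 =>
    have hc := hs.cmp _ h
    rw [cycG_sum h1, Finsupp.finsetSum_apply] at hw
    obtain ⟨i, hi, hv⟩ := Finset.exists_ne_zero_of_sum_ne_zero hw
    have hr := (rotI_cmp hc hg.comp hg.fwd i).1
    rw [bv_supp hv, GG, if_neg (fun e => cmp_ne hr e.1), if_neg (fun e => cmp_ne hr e.1),
      if_pos ⟨rfl, hr⟩]
    simp only
    rw [rp_eq hg.comp hg.fwd hs h (Finset.mem_range.1 hi)]
  | cycG' n C h hn h1 =>
    obtain ⟨c, hc⟩ := some_head (cmp_ne (hs.cmp _ h))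
    rw [yG_eq hc] at hw ⊢
    rw [bv_supp hw, GG_bv (by simp [Triv, xL, extL]) (by simp [xL, extL]) (by simp [xL, extL])]

theorem rot_ne {S : Set (Q.A × Q.A)} (hc : ∀ {a b}, (a, b) ∈ S → Q.tgt a = Q.src b)
    (hf : ∀ {a b b'}, (a, b) ∈ S → (a, b') ∈ S → b = b') {S0 : Set (PathDat Q)}
    (hS : RepSys Q S S0) {q : PathDat Q} (hq : q ∈ S0) {i : ℕ} (hi : i < periodP Q q)
    (e : rotI Q i q = q) : i = 0 := by
  have h1 := rp_eq hc hf hS hq hi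
  have h0 := rp_eq hc hf hS hq (rotI_period hc hf (hS.cmp _ hq)).2
  rw [e] at h1
  change rp S0 q = (q, 0) at h0
  rw [h1] at h0
  exact congrArg Prod.snd h0

theorem GT_ne (hg : Gtl Q R (cpl Q R)) (hb : RepSys Q (cpl Q R) Sb) (hs : RepSys Q R Sg)
    (hV : Nonempty Q.V)
    {n : ℕ} {x : Coch k Q R n} (hx : GT k Q R T Sb Sg n x) : x ≠ 0 := by
  classical
  cases hx with
  | one =>
    obtain ⟨v⟩ := hV
    intro h
    have := DFunLike.congr_fun h (⟨_, gb_ee hg v⟩ : GB Q R 0)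
    rw [oneD, Finsupp.finsetSum_apply] at this
    simp [bv_apply (gb_ee hg _)] at this
  | bmax α hp h => exact bv_ne hp
  | cycB α h =>
    have hc := hb.cmp _ h
    intro h0
    have := DFunLike.congr_fun h0 (⟨_, gb_uB hg hc⟩ : GB Q R 0)
    rw [cycB_sum, Finsupp.finsetSum_apply, Finset.sum_eq_single 0] at this
    · rw [uB, bv_apply (gb_uB hg (rotI_cmp hc hg.comp' hg.fwd' 0).1)] at this
      simp [rotI] at this
    · intro i hi hi0
      by_contra hne
      have e := bv_supp hne
      exact hi0 (rot_ne hg.comp' hg.fwd' hb h (Finset.mem_range.1 hi)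
        (congrArg Prod.snd e).symm)
    · intro hh
      exact absurd (Finset.mem_range.2 (rotI_period hg.comp' hg.fwd' hc).2) hh
  | arr c h => exact bv_ne (gb_ea hg c)
  | cycB' α h =>
    obtain ⟨c, hc⟩ := some_head (cmp_ne (hb.cmp _ h))
    rw [yB_eq hc]
    exact bv_ne (gb_yB hg (hb.cmp _ h) hc)
  | gmax _ v hv h1 h2 h => exact bv_ne hv
  | cycG _ α h hn h1 =>
    have hc := hs.cmp _ h
    subst hn
    intro h0
    have := DFunLike.congr_fun h0 (⟨_, gb_uG hg hc⟩ : GB Q R _)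
    rw [cycG_sum h1, Finsupp.finsetSum_apply, Finset.sum_eq_single 0] at this
    · rw [uG, show rotI Q 0 α = α from rfl, bv_apply (gb_uG hg hc)] at this
      simp at this
    · intro i hi hi0
      by_contra hne
      have e := bv_supp hne
      exact hi0 (rot_ne hg.comp hg.fwd hs h (Finset.mem_range.1 hi)
        (congrArg Prod.fst e).symm)
    · intro hh
      exact absurd (Finset.mem_range.2 (rotI_period hg.comp hg.fwd hc).2) hh
  | cycG' n C h hn h1 =>
    subst hn
    obtain ⟨c, hc⟩ := some_head (cmp_ne (hs.cmp _ h))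
    rw [yG_eq hc]
    exact bv_ne (gb_yG hg (hs.cmp _ h) hc)

theorem gen_indep (hg : Gtl Q R (cpl Q R)) (hb : RepSys Q (cpl Q R) Sb) (hs : RepSys Q R Sg)
    (hV : Nonempty Q.V) (hcon : Connected Q) (n : ℕ) :
    LinearIndependent k (fun x : GenAll k Q R T Sb Sg n => (x : Coch k Q R n)) := by
  apply indep_of_supp
  · intro x hx
    exact GT_ne hg hb hs hV (GT_of hg hb hs hx)
  · intro x hx y hy w hxw hyw
    rw [GT_G hg hb hs hcon (GT_of hg hb hs hx) w hxw, GT_G hg hb hs hcon (GT_of hg hb hs hy) w hyw]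

end

/-- For a gentle presentation `(Q, R)`, a spanning tree `T`,
and choices `Sb = Crep(B)`, `Sg = Crep°(Γ)`, the Hochschild cohomology
`HH^*(kQ/⟨R⟩)` — the cohomology of `k(Γ ∥ B)` — is, as a graded vector space,
freely generated by the cohomology classes of the listed homogeneous cocycles
(H_I)–(H_VIII). -/
theorem hochschild_cohomology_basis (k : Type) [Field k] (Q : Quiv)
    (R : Set (Q.A × Q.A)) (hg : IsGentle Q R) (T : Set Q.A)
    (hT : IsSpanningTree Q T) (Sb Sg : Set (PathDat Q))
    (hSb : IsCrep Q Sb (Cocomplete Q R)) (hSg : IsCrep Q Sg (Complete Q R)) :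
    FreelyGeneratesKer0 k Q R (GenAll k Q R T Sb Sg 0) ∧
    ∀ m : ℕ, FreelyGeneratesCohom k Q R m (GenAll k Q R T Sb Sg (m + 1)) := by
  have hG := gtl_of_gentle hg
  have hb : RepSys Q (cpl Q R) Sb := repSys hG.comp' hG.fwd' cocomplete_iff hSb
  have hs : RepSys Q R Sg := repSys hG.comp hG.fwd (complete_iff hG.comp) hSg
  obtain ⟨τ, hτ0, hτ⟩ := tree_tau k hT
  have hd : ∀ n, ∀ x ∈ GenAll k Q R T Sb Sg n, dLin k Q R n x = 0 := fun n x hx =>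
    GT_d hG hb hs (GT_of hG hb hs hx)
  have hds : ∀ n, ∀ x ∈ Submodule.span k (GenAll k Q R T Sb Sg n), dLin k Q R n x = 0 := by
    intro n x hx
    have : Submodule.span k (GenAll k Q R T Sb Sg n) ≤ LinearMap.ker (dLin k Q R n) :=
      Submodule.span_le.2 fun x hx => hd n x hx
    exact this hx
  have hhs : ∀ n, ∀ x ∈ Submodule.span k (GenAll k Q R T Sb Sg (n + 1)),
      hM k R Sb Sg τ n x = 0 := by
    intro n x hx
    have : Submodule.span k (GenAll k Q R T Sb Sg (n + 1)) ≤
        LinearMap.ker (hM k R Sb Sg τ n) :=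
      Submodule.span_le.2 fun x hx => GT_h hG hb hs hτ0 (GT_of hG hb hs hx)
    exact this hx
  refine ⟨⟨hd 0, fun z hz => ?_, gen_indep hG hb hs hg.nonempty hg.connected 0⟩,
    fun m => ⟨hd (m + 1), fun z hz => ⟨hM k R Sb Sg τ m z, ?_⟩, ?_,
      gen_indep hG hb hs hg.nonempty hg.connected (m + 1)⟩⟩
  · have := pi_all hG hT hg.nonempty hb hs hτ z
    rw [hz, map_zero, sub_zero] at this
    simpa [DH] using this
  · have := pi_all hG hT hg.nonempty hb hs hτ z
    rw [hz, map_zero, sub_zero] at this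
    exact this
  · rintro x hx ⟨y, rfl⟩
    have h1 := pi_all hG hT hg.nonempty hb hs hτ y
    rw [hhs m _ hx, sub_zero] at h1
    have h2 := hds m _ h1
    rw [map_sub, sub_eq_zero] at h2
    rw [h2]
    cases m with
    | zero => simp [DH]
    | succ m => exact dd hG _

end GentleTT
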